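/- arXiv:2209.01544 — 3 statements merged into one kernel-verified Lean document; each statement's English description precedes it below -/
import Mathlib

section
/- Let G_n be an inhomogeneous random graph with type dependence on n vertices. Suppose: (a) the empirical type distributions F_n, viewed as random elements of M([0,1]) with the weak topology, satisfy the large deviation principle with rate ℓ(n) and lower-semicontinuous rate function K : M([0,1]) → [0,∞]; (b) the map F ↦ g^{[F]} is continuous from M([0,1]) (weak topology) to the space of graphons with the L¹-norm; and (c) ℓ(n) = o(n(n−1)/2). Then the laws of the equivalence classes h̃^{G_n} of the empirical graphons of G_n satisfy the large deviation principle on (W̃, δ_□) with rate ℓ(n) and rate function J(h̃) = inf{ K(F) : F ∈ M([0,1]), g̃^{[F]} = h̃ }. -/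
open MeasureTheory Filter
open scoped ENNReal

noncomputable section

/-- The unit square `[0,1]² ⊆ ℝ²`. -/
def unitSq : Set (ℝ × ℝ) := Set.Icc (0:ℝ) 1 ×ˢ Set.Icc (0:ℝ) 1

/-- A graphon: a symmetric measurable function `[0,1]² → [0,1]` (extended to `ℝ²`). -/
def IsGraphon (h : ℝ → ℝ → ℝ) : Prop :=
  Measurable (Function.uncurry h) ∧ (∀ x y, h x y = h y x) ∧ ∀ x y, h x y ∈ Set.Icc (0:ℝ) 1

def GraphonSet : Set (ℝ → ℝ → ℝ) := {h | IsGraphon h}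

/-- The cut distance `d_□`. -/
def cutDist (h₁ h₂ : ℝ → ℝ → ℝ) : ℝ :=
  ⨆ S : {S : Set ℝ // MeasurableSet S ∧ S ⊆ Set.Icc 0 1},
    ⨆ T : {T : Set ℝ // MeasurableSet T ∧ T ⊆ Set.Icc 0 1},
      |∫ p in S.1 ×ˢ T.1, (h₁ p.1 p.2 - h₂ p.1 p.2)|

/-- A measure-preserving bijection of `[0,1]`. -/
structure MPBij where
  toFun : ℝ → ℝ
  bijOn : Set.BijOn toFun (Set.Icc 0 1) (Set.Icc 0 1)
  mp : MeasurePreserving toFun (volume.restrict (Set.Icc 0 1)) (volume.restrict (Set.Icc 0 1))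

instance : Nonempty MPBij := ⟨⟨id, Set.bijOn_id _, MeasurePreserving.id _⟩⟩

/-- Relabelling of a graphon: `h^σ(x,y) = h(σ x, σ y)`. -/
def relabel (σ : MPBij) (h : ℝ → ℝ → ℝ) : ℝ → ℝ → ℝ := fun x y => h (σ.toFun x) (σ.toFun y)

/-- The cut metric `δ_□`. -/
def cutMetric (h₁ h₂ : ℝ → ℝ → ℝ) : ℝ :=
  ⨅ σ₁ : MPBij, ⨅ σ₂ : MPBij, cutDist (relabel σ₁ h₁) (relabel σ₂ h₂)

/-- `L¹` distance of (graphon-type) kernels over the unit square. -/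
def L1dist (h₁ h₂ : ℝ → ℝ → ℝ) : ℝ := ∫ p in unitSq, |h₁ p.1 p.2 - h₂ p.1 p.2|

/-- Bernoulli relative entropy `R(a|b)`, with the conventions `0 log 0 = 0`,
`R(a|0) = ∞` for `a > 0`, `R(a|1) = ∞` for `a < 1`. -/
def relEnt (a b : ℝ) : ℝ≥0∞ :=
  if b ≤ 0 then (if a ≤ 0 then 0 else ∞)
  else if 1 ≤ b then (if 1 ≤ a then 0 else ∞)
  else ENNReal.ofReal (a * Real.log (a / b) + (1 - a) * Real.log ((1 - a) / (1 - b)))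

/-- The rate function `I_r(h) = ∫_{[0,1]²} R(h(x,y)|r(x,y)) dx dy`. -/
def Irate (r h : ℝ → ℝ → ℝ) : ℝ≥0∞ := ∫⁻ p in unitSq, relEnt (h p.1 p.2) (r p.1 p.2)

/-- `Ĩ_r(h̃) = inf_σ I_r(h^σ)`. -/
def IrateTilde (r h : ℝ → ℝ → ℝ) : ℝ≥0∞ := ⨅ σ : MPBij, Irate r (relabel σ h)

/-- Closed subsets of graphon space for the (pseudo)metric `δ_□`; these correspond exactly to
the closed subsets of the quotient space `(W̃, δ_□)`. -/
def DeltaClosedIn (C : Set (ℝ → ℝ → ℝ)) : Prop :=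
  C ⊆ GraphonSet ∧ ∀ h ∈ GraphonSet, h ∉ C → ∃ ε > 0, ∀ g ∈ GraphonSet, cutMetric g h < ε → g ∉ C

/-- Open subsets of graphon space for the (pseudo)metric `δ_□`; these correspond exactly to
the open subsets of the quotient space `(W̃, δ_□)`. -/
def DeltaOpenIn (O : Set (ℝ → ℝ → ℝ)) : Prop :=
  O ⊆ GraphonSet ∧ ∀ h ∈ O, ∃ ε > 0, ∀ g ∈ GraphonSet, cutMetric g h < ε → g ∈ O

/-- `M([0,1])`: Borel probability measures on `[0,1]` with the topology of weak convergence. -/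
abbrev M01 := ProbabilityMeasure ↥(Set.Icc (0:ℝ) 1)

/-- empirical measure of a type vector -/
def empMeasAux {n : ℕ} (x : Fin n → ↥(Set.Icc (0:ℝ) 1)) : Measure ↥(Set.Icc (0:ℝ) 1) :=
  (n : ℝ≥0∞)⁻¹ • ∑ i : Fin n, Measure.dirac (x i)

lemma empMeasAux_isProb {n : ℕ} (hn : n ≠ 0) (x : Fin n → ↥(Set.Icc (0:ℝ) 1)) :
    IsProbabilityMeasure (empMeasAux x) := by
  constructor
  simp only [empMeasAux, Measure.smul_apply, Measure.coe_finset_sum, Finset.sum_apply,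
    measure_univ, Finset.sum_const, Finset.card_univ, Fintype.card_fin, nsmul_eq_mul, mul_one,
    smul_eq_mul]
  exact ENNReal.inv_mul_cancel (by exact_mod_cast hn) (by simp)

/-- The empirical type distribution `F_n` as an element of `M([0,1])`. -/
def empMeas {n : ℕ} (x : Fin n → ↥(Set.Icc (0:ℝ) 1)) : M01 :=
  if h : n = 0 then ⟨Measure.dirac ⟨0, Set.left_mem_Icc.mpr zero_le_one⟩, inferInstance⟩
  else ⟨empMeasAux x, empMeasAux_isProb h x⟩

/-- The cumulative distribution function of `F ∈ M([0,1])`. -/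
def cdfM (F : M01) (x : ℝ) : ℝ :=
  ((F : Measure ↥(Set.Icc (0:ℝ) 1)) {t | (t : ℝ) ≤ x}).toReal

/-- The right-continuous generalised inverse `F̄(u) = inf{x ∈ [0,1] : F(x) > u}`. -/
def geninv (F : M01) (u : ℝ) : ℝ := sInf {x | x ∈ Set.Icc (0:ℝ) 1 ∧ u < cdfM F x}

/-- The induced reference graphon `g^{[F]}(x,y) = H(F̄(x), F̄(y), F)`. -/
def inducedGraphon (Hfun : ℝ → ℝ → M01 → ℝ) (F : M01) : ℝ → ℝ → ℝ :=
  fun x y => Hfun (geninv F x) (geninv F y) F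

/-- The vertex `⌈n x⌉` containing the point `x`. -/
def vertexOf (n : ℕ) (x : ℝ) : ℕ := (⌈(n : ℝ) * x⌉).toNat

open Classical in
/-- The empirical graphon of the graph on `[n]` with adjacency relation `A`. -/
def empGraphon {n : ℕ} (A : Fin n → Fin n → Prop) : ℝ → ℝ → ℝ :=
  fun x y =>
    if h : vertexOf n x - 1 < n ∧ vertexOf n y - 1 < n then
      (if A ⟨vertexOf n x - 1, h.1⟩ ⟨vertexOf n y - 1, h.2⟩ then 1 else 0)
    else 0

/-- Adjacency of the IRGT: given the types `x` and i.i.d. uniforms `u`, the edge `ij` is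
active iff `u_{ij} ≤ H(X_i, X_j, F_n)`. -/
def irgtAdj (Hfun : ℝ → ℝ → M01 → ℝ) {n : ℕ} (x : Fin n → ↥(Set.Icc (0:ℝ) 1))
    (u : Fin n × Fin n → ℝ) (i j : Fin n) : Prop :=
  i ≠ j ∧ u (min i j, max i j) ≤ Hfun (x i : ℝ) (x j : ℝ) (empMeas x)

/-- Adjacency of the inhomogeneous Erdős–Rényi graph with reference graphon `r`: the edge `ij`
(`i,j ∈ {1,…,n}`) is active iff `u_{ij} ≤ r(i/n, j/n)`. -/
def erAdj (r : ℝ → ℝ → ℝ) {n : ℕ} (u : Fin n × Fin n → ℝ) (i j : Fin n) : Prop :=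
  i ≠ j ∧ u (min i j, max i j) ≤ r (((i : ℕ) + 1 : ℝ) / n) (((j : ℕ) + 1 : ℝ) / n)

/-- i.i.d. uniforms on `[0,1]`, one for each (potential) edge. -/
def cubeMeasure (n : ℕ) : Measure (Fin n × Fin n → ℝ) :=
  Measure.pi fun _ => volume.restrict (Set.Icc 0 1)

/-- `n(n-1)/2` as a real-valued rate. -/
def binom2 (n : ℕ) : ℝ := (n : ℝ) * ((n : ℝ) - 1) / 2

/-- The large deviation principle, with speed `a` and rate function `R`, for the laws of the
random elements `f n` (defined on the probability spaces `(Ω n, μ n)`) of a topological space. -/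
def SatisfiesLDP {Λ : Type*} [TopologicalSpace Λ] {Ω : ℕ → Type*} [∀ n, MeasurableSpace (Ω n)]
    (μ : ∀ n, Measure (Ω n)) (f : ∀ n, Ω n → Λ) (a : ℕ → ℝ) (R : Λ → ℝ≥0∞) : Prop :=
  Tendsto a atTop atTop ∧
  (∀ C : Set Λ, IsClosed C →
    atTop.limsup (fun n => (((a n)⁻¹ : ℝ) : EReal) * ENNReal.log (μ n (f n ⁻¹' C)))
      ≤ -(⨅ x ∈ C, (R x : EReal))) ∧
  (∀ O : Set Λ, IsOpen O →
    -(⨅ x ∈ O, (R x : EReal)) ≤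
      atTop.liminf (fun n => (((a n)⁻¹ : ℝ) : EReal) * ENNReal.log (μ n (f n ⁻¹' O))))

/-- The large deviation principle on `(W̃, δ_□)`, with speed `a` and rate function `R`, for the
laws of the equivalence classes of the graphon-valued random elements `f n`. -/
def GraphonLDP {Ω : ℕ → Type*} [∀ n, MeasurableSpace (Ω n)]
    (μ : ∀ n, Measure (Ω n)) (f : ∀ n, Ω n → (ℝ → ℝ → ℝ)) (a : ℕ → ℝ)
    (R : (ℝ → ℝ → ℝ) → ℝ≥0∞) : Prop :=
  Tendsto a atTop atTop ∧
  (∀ C : Set (ℝ → ℝ → ℝ), DeltaClosedIn C →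
    atTop.limsup (fun n => (((a n)⁻¹ : ℝ) : EReal) * ENNReal.log (μ n (f n ⁻¹' C)))
      ≤ -(⨅ h ∈ C, (R h : EReal))) ∧
  (∀ O : Set (ℝ → ℝ → ℝ), DeltaOpenIn O →
    -(⨅ h ∈ O, (R h : EReal)) ≤
      atTop.liminf (fun n => (((a n)⁻¹ : ℝ) : EReal) * ENNReal.log (μ n (f n ⁻¹' O))))

end

lemma inv_mul_log_le_iff {ℓ : ℝ} (hℓ : 0 < ℓ) (c : ℝ) (a : ℝ≥0∞) :
    ((ℓ⁻¹ : ℝ) : EReal) * ENNReal.log a ≤ c ↔ a ≤ ENNReal.ofReal (Real.exp (c * ℓ)) := by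
  rw [← ENNReal.log_le_log_iff, ENNReal.log_ofReal_of_pos (Real.exp_pos _), Real.log_exp]
  generalize ENNReal.log a = y
  induction y using EReal.rec with
  | bot => simp [EReal.coe_mul_bot_of_pos (inv_pos.2 hℓ), -EReal.coe_mul]
  | top => rw [EReal.coe_mul_top_of_pos (inv_pos.2 hℓ)]; simp [-EReal.coe_mul]
  | coe y =>
    rw [← EReal.coe_mul, EReal.coe_le_coe_iff, EReal.coe_le_coe_iff, inv_mul_le_iff₀ hℓ,
      mul_comm]

lemma le_inv_mul_log_iff {ℓ : ℝ} (hℓ : 0 < ℓ) (c : ℝ) (a : ℝ≥0∞) :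
    (c : EReal) ≤ ((ℓ⁻¹ : ℝ) : EReal) * ENNReal.log a ↔ ENNReal.ofReal (Real.exp (c * ℓ)) ≤ a := by
  rw [← ENNReal.log_le_log_iff, ENNReal.log_ofReal_of_pos (Real.exp_pos _), Real.log_exp]
  generalize ENNReal.log a = y
  induction y using EReal.rec with
  | bot => simp [EReal.coe_mul_bot_of_pos (inv_pos.2 hℓ), -EReal.coe_mul]
  | top => rw [EReal.coe_mul_top_of_pos (inv_pos.2 hℓ)]; simp [-EReal.coe_mul]
  | coe y =>
    rw [← EReal.coe_mul, EReal.coe_le_coe_iff, EReal.coe_le_coe_iff, le_inv_mul_iff₀ hℓ,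
      mul_comm]

lemma eventually_le_exp_of_limsup_lt {ℓ : ℕ → ℝ} (hℓ : Tendsto ℓ atTop atTop) {a : ℕ → ℝ≥0∞}
    {c : ℝ}
    (h : atTop.limsup (fun n => (((ℓ n)⁻¹ : ℝ) : EReal) * ENNReal.log (a n)) < c) :
    ∀ᶠ n in atTop, a n ≤ ENNReal.ofReal (Real.exp (c * ℓ n)) := by
  filter_upwards [eventually_lt_of_limsup_lt h, hℓ.eventually_gt_atTop 0] with n h1 h2
  exact (inv_mul_log_le_iff h2 c _).1 h1.le

lemma limsup_le_of_eventually_le_exp {ℓ : ℕ → ℝ} (hℓ : Tendsto ℓ atTop atTop) {a : ℕ → ℝ≥0∞}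
    {c : ℝ} (h : ∀ᶠ n in atTop, a n ≤ ENNReal.ofReal (Real.exp (c * ℓ n))) :
    atTop.limsup (fun n => (((ℓ n)⁻¹ : ℝ) : EReal) * ENNReal.log (a n)) ≤ c := by
  refine limsup_le_of_le (by isBoundedDefault) ?_
  filter_upwards [h, hℓ.eventually_gt_atTop 0] with n h1 h2
  exact (inv_mul_log_le_iff h2 c _).2 h1

lemma eventually_exp_le_of_lt_liminf {ℓ : ℕ → ℝ} (hℓ : Tendsto ℓ atTop atTop) {a : ℕ → ℝ≥0∞}
    {c : ℝ}
    (h : c < atTop.liminf (fun n => (((ℓ n)⁻¹ : ℝ) : EReal) * ENNReal.log (a n))) :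
    ∀ᶠ n in atTop, ENNReal.ofReal (Real.exp (c * ℓ n)) ≤ a n := by
  filter_upwards [eventually_lt_of_lt_liminf h, hℓ.eventually_gt_atTop 0] with n h1 h2
  exact (le_inv_mul_log_iff h2 c _).1 h1.le

lemma le_liminf_of_eventually_exp_le {ℓ : ℕ → ℝ} (hℓ : Tendsto ℓ atTop atTop) {a : ℕ → ℝ≥0∞}
    {c : ℝ} (h : ∀ᶠ n in atTop, ENNReal.ofReal (Real.exp (c * ℓ n)) ≤ a n) :
    c ≤ atTop.liminf (fun n => (((ℓ n)⁻¹ : ℝ) : EReal) * ENNReal.log (a n)) := by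
  refine le_liminf_of_le (by isBoundedDefault) ?_
  filter_upwards [h, hℓ.eventually_gt_atTop 0] with n h1 h2
  exact (le_inv_mul_log_iff h2 c _).2 h1

/-- Multiplicative constants do not matter on the exponential scale. -/
lemma eventually_two_mul_exp_le {ℓ : ℕ → ℝ} (hℓ : Tendsto ℓ atTop atTop) {b c : ℝ} (h : b < c) :
    ∀ᶠ n in atTop, 2 * Real.exp (b * ℓ n) ≤ Real.exp (c * ℓ n) := by
  have h0 : 0 < c - b := sub_pos.2 h
  filter_upwards [hℓ.eventually_ge_atTop (1 / (c - b))] with n hn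
  have h1 : 1 ≤ (c - b) * ℓ n := by rwa [div_le_iff₀' h0] at hn
  have h2 : 2 ≤ Real.exp ((c - b) * ℓ n) := by linarith [Real.add_one_le_exp ((c - b) * ℓ n)]
  calc 2 * Real.exp (b * ℓ n) ≤ Real.exp ((c - b) * ℓ n) * Real.exp (b * ℓ n) := by gcongr
    _ = Real.exp (c * ℓ n) := by rw [← Real.exp_add]; ring_nf

instance isProbabilityMeasure_restrict_Icc :
    IsProbabilityMeasure (volume.restrict (Set.Icc (0:ℝ) 1)) := ⟨by simp⟩

instance isProbabilityMeasure_cubeMeasure (n : ℕ) : IsProbabilityMeasure (cubeMeasure n) := by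
  unfold cubeMeasure; infer_instance

/-- The centred indicator of an edge with probability `p`, as a function of its uniform `v`. -/
noncomputable def edgeDev (p v : ℝ) : ℝ := (if v ≤ p then 1 else 0) - p

lemma measurable_edgeDev : Measurable (Function.uncurry edgeDev) := by
  unfold edgeDev Function.uncurry
  exact (Measurable.ite (measurableSet_le measurable_snd measurable_fst) measurable_const
    measurable_const).sub measurable_fst

lemma abs_edgeDev_le {p : ℝ} (hp : p ∈ Set.Icc (0:ℝ) 1) (v : ℝ) : |edgeDev p v| ≤ 1 := by
  obtain ⟨h0, h1⟩ := hp
  unfold edgeDev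
  rw [abs_le]
  split_ifs <;> constructor <;> linarith

lemma integral_edgeDev {p : ℝ} (hp : p ∈ Set.Icc (0:ℝ) 1) :
    ∫ v in Set.Icc (0:ℝ) 1, edgeDev p v = 0 := by
  obtain ⟨h0, h1⟩ := hp
  have h : (fun v : ℝ => if v ≤ p then (1:ℝ) else 0) = (Set.Iic p).indicator 1 := by
    ext v; simp [Set.indicator_apply]
  unfold edgeDev
  rw [integral_sub, h, integral_indicator_one measurableSet_Iic]
  · have hI : Set.Iic p ∩ Set.Icc 0 1 = Set.Icc 0 p := by
      ext v; simp only [Set.mem_inter_iff, Set.mem_Iic, Set.mem_Icc]; grind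
    rw [measureReal_restrict_apply measurableSet_Iic, hI]
    simp [h0]
  · rw [h]
    exact (integrable_const (1:ℝ)).indicator measurableSet_Iic
  · exact integrable_const _

lemma cubeMeasure_weighted_sum_ge_le {n : ℕ} {p w : Fin n × Fin n → ℝ}
    (hp : ∀ e, p e ∈ Set.Icc (0:ℝ) 1) (hw : ∀ e, |w e| ≤ 1) {t : ℝ} (ht : 0 ≤ t) :
    (cubeMeasure n).real {u | t ≤ ∑ e, w e * edgeDev (p e) (u e)}
      ≤ Real.exp (-t ^ 2 / (2 * n ^ 2)) := by
  have hm : ∀ e, Measurable fun v => w e * edgeDev (p e) v := fun e =>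
    (measurable_edgeDev.comp (measurable_const.prodMk measurable_id)).const_mul _
  have hind : ProbabilityTheory.iIndepFun
      (fun (e : Fin n × Fin n) (u : Fin n × Fin n → ℝ) => w e * edgeDev (p e) (u e))
      (cubeMeasure n) :=
    ProbabilityTheory.iIndepFun_pi (X := fun e v => w e * edgeDev (p e) v)
      fun e => (hm e).aemeasurable
  have hsub : ∀ e ∈ (Finset.univ : Finset (Fin n × Fin n)),
      ProbabilityTheory.HasSubgaussianMGF
        (fun u : Fin n × Fin n → ℝ => w e * edgeDev (p e) (u e)) 1 (cubeMeasure n) := by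
    intro e _
    have hc : ∫ u, w e * edgeDev (p e) (u e) ∂(cubeMeasure n) = 0 := by
      refine (integral_comp_eval (μ := fun _ : Fin n × Fin n => volume.restrict (Set.Icc (0:ℝ) 1))
        (f := fun v => w e * edgeDev (p e) v) (hm e).aestronglyMeasurable).trans ?_
      rw [integral_const_mul, integral_edgeDev (hp e), mul_zero]
    have := ProbabilityTheory.hasSubgaussianMGF_of_mem_Icc_of_integral_eq_zero
      (μ := cubeMeasure n) (a := -1) (b := 1)
      ((hm e).comp (measurable_pi_apply e)).aemeasurable
      (ae_of_all _ fun u => by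
        have h1 : |w e * edgeDev (p e) (u e)| ≤ 1 := by
          rw [abs_mul]; exact mul_le_one₀ (hw e) (abs_nonneg _) (abs_edgeDev_le (hp e) _)
        exact abs_le.1 h1) hc
    have hnorm : ‖(1:ℝ) - -1‖₊ = 2 := by ext; norm_num
    rw [hnorm, div_self two_ne_zero, one_pow] at this
    exact this
  have := ProbabilityTheory.HasSubgaussianMGF.measure_sum_ge_le_of_iIndepFun hind hsub ht
  refine this.trans (le_of_eq ?_)
  congr 2
  simp; ring

/-- The pairs `i < j` with `i ∈ S` and `j ∈ T`. -/
def upperPairs {n : ℕ} (S T : Finset (Fin n)) : Finset (Fin n × Fin n) :=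
  (S ×ˢ T).filter fun e => e.1 < e.2

/-- The event that the number of edges between some two vertex sets deviates a lot. -/
def deviationSet {n : ℕ} (ε : ℝ) (p : Fin n → Fin n → ℝ) : Set (Fin n × Fin n → ℝ) :=
  {u | ∃ S T : Finset (Fin n),
    ε * n ^ 2 ≤ |∑ e ∈ upperPairs S T, edgeDev (p e.1 e.2) (u e)|}

lemma cubeMeasure_abs_sum_ge_le {n : ℕ} {p : Fin n × Fin n → ℝ}
    (hp : ∀ e, p e ∈ Set.Icc (0:ℝ) 1) (E : Finset (Fin n × Fin n)) {t : ℝ} (ht : 0 ≤ t) :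
    cubeMeasure n {u | t ≤ |∑ e ∈ E, edgeDev (p e) (u e)|}
      ≤ ENNReal.ofReal (2 * Real.exp (-t ^ 2 / (2 * n ^ 2))) := by
  classical
  have h1 := cubeMeasure_weighted_sum_ge_le (w := fun e => if e ∈ E then 1 else 0) hp
    (fun e => by split_ifs <;> simp) ht
  have h2 := cubeMeasure_weighted_sum_ge_le (w := fun e => if e ∈ E then -1 else 0) hp
    (fun e => by split_ifs <;> simp) ht
  rw [← ENNReal.ofReal_toReal (measure_ne_top (cubeMeasure n) _)]
  refine ENNReal.ofReal_le_ofReal ?_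
  refine le_trans (measureReal_mono ?_ (measure_ne_top _ _)) ((measureReal_union_le _ _).trans
    ((add_le_add h1 h2).trans (le_of_eq (two_mul _).symm)))
  intro u hu
  simpa [ite_mul, Finset.sum_ite_mem, le_abs] using hu

lemma cubeMeasure_deviationSet_le {n : ℕ} {ε : ℝ} (hε : 0 ≤ ε) {p : Fin n → Fin n → ℝ}
    (hp : ∀ i j, p i j ∈ Set.Icc (0:ℝ) 1) :
    cubeMeasure n (deviationSet ε p)
      ≤ ENNReal.ofReal (4 ^ n * (2 * Real.exp (-(ε ^ 2 * n ^ 2 / 2)))) := by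
  have h : deviationSet ε p = ⋃ q : Finset (Fin n) × Finset (Fin n),
      {u | ε * n ^ 2 ≤ |∑ e ∈ upperPairs q.1 q.2, edgeDev (p e.1 e.2) (u e)|} := by
    ext u; simp [deviationSet]
  rw [h]
  refine (measure_iUnion_fintype_le _ _).trans ?_
  refine (Finset.sum_le_sum fun q _ => cubeMeasure_abs_sum_ge_le (p := fun e => p e.1 e.2)
    (fun e => hp _ _) (upperPairs q.1 q.2) (by positivity)).trans (le_of_eq ?_)
  rw [Finset.sum_const, nsmul_eq_mul, ENNReal.ofReal_mul (p := 4 ^ n) (by positivity)]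
  congr 1
  · simp [← mul_pow]
  · congr 3
    rcases Nat.eq_zero_or_pos n with rfl | hn
    · simp
    · field_simp

lemma abs_sum_mul_le_of_forall_finset {ι : Type*} [Fintype ι] {a d : ι → ℝ} {c M : ℝ}
    (hc : 0 ≤ c) (ha : ∀ i, a i ∈ Set.Icc 0 c) (hd : ∀ P : Finset ι, |∑ i ∈ P, d i| ≤ M) :
    |∑ i, a i * d i| ≤ c * M := by
  classical
  have key : ∀ d : ι → ℝ, (∀ P : Finset ι, |∑ i ∈ P, d i| ≤ M) → ∑ i, a i * d i ≤ c * M := by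
    intro d hd
    calc ∑ i, a i * d i ≤ ∑ i, if 0 < d i then c * d i else 0 := by
          refine Finset.sum_le_sum fun i _ => ?_
          split_ifs with h
          · exact mul_le_mul_of_nonneg_right (ha i).2 h.le
          · exact mul_nonpos_of_nonneg_of_nonpos (ha i).1 (not_lt.1 h)
      _ = c * ∑ i with 0 < d i, d i := by rw [← Finset.sum_filter, Finset.mul_sum]
      _ ≤ c * M := mul_le_mul_of_nonneg_left ((le_abs_self _).trans (hd _)) hc
  rw [abs_le]
  refine ⟨?_, key d hd⟩
  have := key (fun i => -d i) (fun P => by simpa using hd P)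
  simp only [mul_neg, Finset.sum_neg_distrib] at this
  linarith

lemma abs_bilinear_le_of_forall_finset {ι : Type*} [Fintype ι] {a b : ι → ℝ} {D : ι → ι → ℝ}
    {c M : ℝ} (hc : 0 ≤ c) (ha : ∀ i, a i ∈ Set.Icc 0 c) (hb : ∀ i, b i ∈ Set.Icc 0 c)
    (hD : ∀ P Q : Finset ι, |∑ i ∈ P, ∑ j ∈ Q, D i j| ≤ M) :
    |∑ i, ∑ j, a i * b j * D i j| ≤ c * (c * M) := by
  have h : ∑ i, ∑ j, a i * b j * D i j = ∑ i, a i * ∑ j, b j * D i j := by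
    simp_rw [Finset.mul_sum, mul_assoc]
  rw [h]
  refine abs_sum_mul_le_of_forall_finset hc ha fun P => ?_
  have h' : ∑ i ∈ P, ∑ j, b j * D i j = ∑ j, b j * ∑ i ∈ P, D i j := by
    rw [Finset.sum_comm]; simp_rw [Finset.mul_sum]
  rw [h']
  refine abs_sum_mul_le_of_forall_finset hc hb fun Q => ?_
  rw [Finset.sum_comm]
  exact hD P Q

open Classical in
/-- Outside the deviation event, the adjacency matrix is close to its mean in cut norm. -/
lemma abs_sum_adj_sub_le {n : ℕ} {ε : ℝ} {p : Fin n → Fin n → ℝ}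
    (hp : ∀ i j, p i j ∈ Set.Icc (0:ℝ) 1) (hsymm : ∀ i j, p i j = p j i)
    {u : Fin n × Fin n → ℝ} (hu : u ∉ deviationSet ε p) (P Q : Finset (Fin n)) :
    |∑ i ∈ P, ∑ j ∈ Q, ((if i ≠ j ∧ u (min i j, max i j) ≤ p i j then (1:ℝ) else 0) - p i j)|
      ≤ 2 * (ε * n ^ 2) + n := by
  have hdev : ∀ S T : Finset (Fin n),
      |∑ e ∈ upperPairs S T, edgeDev (p e.1 e.2) (u e)| ≤ ε * n ^ 2 := by
    intro S T
    by_contra! h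
    exact hu ⟨S, T, h.le⟩
  set D : Fin n × Fin n → ℝ := fun e =>
    (if e.1 ≠ e.2 ∧ u (min e.1 e.2, max e.1 e.2) ≤ p e.1 e.2 then (1:ℝ) else 0) - p e.1 e.2
    with hDdef
  have hsplit : ∑ i ∈ P, ∑ j ∈ Q, D (i, j)
      = ∑ e ∈ (P ×ˢ Q) with e.1 < e.2, D e + (∑ e ∈ (P ×ˢ Q) with e.2 < e.1, D e
        + ∑ e ∈ (P ×ˢ Q) with e.1 = e.2, D e) := by
    rw [← Finset.sum_product', ← Finset.sum_filter_add_sum_filter_not (P ×ˢ Q) (fun e => e.1 < e.2)]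
    congr 1
    rw [← Finset.sum_filter_add_sum_filter_not _ (fun e => e.2 < e.1), Finset.filter_filter,
      Finset.filter_filter]
    congr 2 <;> ext e <;> simp <;> grind
  have h1 : ∑ e ∈ (P ×ˢ Q) with e.1 < e.2, D e
      = ∑ e ∈ upperPairs P Q, edgeDev (p e.1 e.2) (u e) := by
    refine Finset.sum_congr rfl fun e he => ?_
    have h := (Finset.mem_filter.1 he).2
    simp [hDdef, edgeDev, h.ne, min_eq_left h.le, max_eq_right h.le]
  have h2 : ∑ e ∈ (P ×ˢ Q) with e.2 < e.1, D e
      = ∑ e ∈ upperPairs Q P, edgeDev (p e.1 e.2) (u e) := by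
    refine Finset.sum_nbij' Prod.swap Prod.swap ?_ ?_ (by simp) (by simp) ?_
    · simp [upperPairs]; tauto
    · simp [upperPairs]; tauto
    · intro e he
      have h := (Finset.mem_filter.1 he).2
      simp [hDdef, edgeDev, h.ne', min_eq_right h.le, max_eq_left h.le, hsymm e.2 e.1, Prod.swap]
  have h3 : |∑ e ∈ (P ×ˢ Q) with e.1 = e.2, D e| ≤ n := by
    refine (Finset.abs_sum_le_sum_abs _ _).trans ?_
    have hle : ∀ e ∈ (P ×ˢ Q).filter (fun e => e.1 = e.2), |D e| ≤ 1 := by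
      intro e he
      have h := (Finset.mem_filter.1 he).2
      simpa [hDdef, h, abs_of_nonneg (hp _ _).1] using (hp e.2 e.2).2
    refine (Finset.sum_le_card_nsmul _ _ 1 hle).trans ?_
    have hcard : ((P ×ˢ Q).filter (fun e => e.1 = e.2)).card ≤ n := by
      have : Set.InjOn Prod.fst (((P ×ˢ Q).filter (fun e => e.1 = e.2) : Finset _) : Set (Fin n × Fin n)) := by
        intro e he f hf hef
        simp at he hf
        ext <;> grind
      rw [← Finset.card_image_of_injOn this]
      simpa using Finset.card_le_univ (((P ×ˢ Q).filter (fun e => e.1 = e.2)).image Prod.fst)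
    simpa using hcard
  change |∑ i ∈ P, ∑ j ∈ Q, D (i, j)| ≤ _
  rw [hsplit, h1, h2]
  have := hdev P Q
  have := hdev Q P
  rw [abs_le] at *
  constructor <;> linarith

/-- `f` and `g` differ by at most `ε` in cut distance. -/
def CutClose (ε : ℝ) (f g : ℝ → ℝ → ℝ) : Prop :=
  ∀ S T : Set ℝ, MeasurableSet S → S ⊆ Set.Icc 0 1 → MeasurableSet T → T ⊆ Set.Icc 0 1 →
    |∫ p in S ×ˢ T, (f p.1 p.2 - g p.1 p.2)| ≤ ε

lemma CutClose.nonneg {ε : ℝ} {f g : ℝ → ℝ → ℝ} (h : CutClose ε f g) : 0 ≤ ε := by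
  simpa using h ∅ ∅ .empty (Set.empty_subset _) .empty (Set.empty_subset _)

lemma CutClose.mono {ε δ : ℝ} {f g : ℝ → ℝ → ℝ} (h : CutClose ε f g) (hle : ε ≤ δ) :
    CutClose δ f g := fun S T hS hS' hT hT' => (h S T hS hS' hT hT').trans hle

lemma CutClose.cutDist_le {ε : ℝ} {f g : ℝ → ℝ → ℝ} (h : CutClose ε f g) : cutDist f g ≤ ε :=
  Real.iSup_le (fun S => Real.iSup_le
    (fun T => h S.1 T.1 S.2.1 S.2.2 T.2.1 T.2.2) h.nonneg) h.nonneg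

lemma cutDist_nonneg (f g : ℝ → ℝ → ℝ) : 0 ≤ cutDist f g :=
  Real.iSup_nonneg fun _ => Real.iSup_nonneg fun _ => abs_nonneg _

lemma cutMetric_nonneg (f g : ℝ → ℝ → ℝ) : 0 ≤ cutMetric f g :=
  Real.iInf_nonneg fun _ => Real.iInf_nonneg fun _ => cutDist_nonneg _ _

lemma cutMetric_le_cutDist_relabel (σ₁ σ₂ : MPBij) (f g : ℝ → ℝ → ℝ) :
    cutMetric f g ≤ cutDist (relabel σ₁ f) (relabel σ₂ g) :=
  (ciInf_le ⟨0, Set.forall_mem_range.2 fun _ => Real.iInf_nonneg fun _ => cutDist_nonneg _ _⟩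
    σ₁).trans (ciInf_le ⟨0, Set.forall_mem_range.2 fun _ => cutDist_nonneg _ _⟩ σ₂)

lemma CutClose.cutMetric_le {ε : ℝ} {f g : ℝ → ℝ → ℝ} {σ : MPBij}
    (h : CutClose ε (relabel σ f) g) : cutMetric f g ≤ ε :=
  (cutMetric_le_cutDist_relabel σ ⟨id, Set.bijOn_id _, MeasurePreserving.id _⟩ f g).trans
    h.cutDist_le

lemma cutMetric_self (f : ℝ → ℝ → ℝ) : cutMetric f f = 0 := by
  refine le_antisymm (CutClose.cutMetric_le (σ := ⟨id, Set.bijOn_id _, MeasurePreserving.id _⟩) ?_)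
    (cutMetric_nonneg _ _)
  intro S T _ _ _ _
  simp [relabel]

lemma IsGraphon.relabel {f : ℝ → ℝ → ℝ} (hf : IsGraphon f) (σ : MPBij) :
    IsGraphon (relabel σ f) :=
  ⟨hf.1.comp ((σ.mp.measurable.comp measurable_fst).prodMk
    (σ.mp.measurable.comp measurable_snd)), fun _ _ => hf.2.1 _ _, fun _ _ => hf.2.2 _ _⟩

lemma volume_unitSq : volume unitSq = 1 := by
  rw [unitSq, Measure.volume_eq_prod, Measure.prod_prod]; simp

lemma prod_subset_unitSq {S T : Set ℝ} (hS : S ⊆ Set.Icc 0 1) (hT : T ⊆ Set.Icc 0 1) :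
    S ×ˢ T ⊆ unitSq := Set.prod_mono hS hT

lemma IsGraphon.integrableOn {f : ℝ → ℝ → ℝ} (hf : IsGraphon f) {A : Set (ℝ × ℝ)}
    (hA : A ⊆ unitSq) : IntegrableOn (fun p : ℝ × ℝ => f p.1 p.2) A := by
  have : IsFiniteMeasure (volume.restrict unitSq) := ⟨by simp [volume_unitSq]⟩
  have h : IntegrableOn (fun p : ℝ × ℝ => f p.1 p.2) unitSq :=
    Integrable.of_mem_Icc 0 1 hf.1.aemeasurable (ae_of_all _ fun p => hf.2.2 p.1 p.2)
  exact h.mono_set hA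

lemma CutClose.trans {ε δ : ℝ} {f g h : ℝ → ℝ → ℝ} (hf : IsGraphon f) (hg : IsGraphon g)
    (hh : IsGraphon h) (h₁ : CutClose ε f g) (h₂ : CutClose δ g h) : CutClose (ε + δ) f h := by
  intro S T hS hS' hT hT'
  have hsub := prod_subset_unitSq hS' hT'
  have hint := integral_add ((hf.integrableOn hsub).sub (hg.integrableOn hsub))
    ((hg.integrableOn hsub).sub (hh.integrableOn hsub))
  simp only [Pi.sub_apply, sub_add_sub_cancel] at hint
  rw [hint]
  exact (abs_add_le _ _).trans (add_le_add (h₁ S T hS hS' hT hT') (h₂ S T hS hS' hT hT'))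

lemma abs_setIntegral_sub_le_L1dist {f g : ℝ → ℝ → ℝ} (hf : IsGraphon f) (hg : IsGraphon g)
    {A : Set (ℝ × ℝ)} (hA : A ⊆ unitSq) :
    |∫ p in A, (f p.1 p.2 - g p.1 p.2)| ≤ L1dist f g := by
  refine (abs_integral_le_integral_abs).trans ?_
  exact setIntegral_mono_set ((hf.integrableOn subset_rfl).sub (hg.integrableOn subset_rfl)).abs
    (ae_of_all _ fun p => abs_nonneg _) hA.eventuallyLE

lemma cutClose_of_L1dist_le {f g : ℝ → ℝ → ℝ} (hf : IsGraphon f) (hg : IsGraphon g) {ε : ℝ}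
    (h : L1dist f g ≤ ε) : CutClose ε f g := fun _ _ _ hS _ hT =>
  (abs_setIntegral_sub_le_L1dist hf hg (prod_subset_unitSq hS hT)).trans h

/-- The interior of the `k`-th of `n` equal subintervals of `[0,1]`. -/
def block {n : ℕ} (k : Fin n) : Set ℝ := Set.Ioo ((k : ℝ) / n) (((k : ℝ) + 1) / n)

lemma measurableSet_block {n : ℕ} (k : Fin n) : MeasurableSet (block k) := measurableSet_Ioo

lemma mem_block_iff {n : ℕ} {k : Fin n} {x : ℝ} :
    x ∈ block k ↔ (k : ℝ) < n * x ∧ n * x < k + 1 := by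
  have hn : (0 : ℝ) < n := by exact_mod_cast k.pos
  rw [block, Set.mem_Ioo, div_lt_iff₀' hn, lt_div_iff₀' hn]

lemma volume_block {n : ℕ} (k : Fin n) : volume.real (block k) = 1 / n := by
  have hn : (0 : ℝ) < n := by exact_mod_cast k.pos
  have h : (k : ℝ) / n ≤ ((k : ℝ) + 1) / n := by gcongr; linarith
  rw [block, Real.volume_real_Ioo_of_le h]
  ring

lemma block_subset {n : ℕ} (k : Fin n) : block k ⊆ Set.Icc 0 1 := by
  intro x hx
  have hn : (0 : ℝ) < n := by exact_mod_cast k.pos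
  have hk : (k : ℝ) + 1 ≤ n := by exact_mod_cast k.2
  obtain ⟨h1, h2⟩ := mem_block_iff.1 hx
  have h0 : (0 : ℝ) ≤ k := Nat.cast_nonneg _
  constructor
  · by_contra! h
    nlinarith
  · by_contra! h
    nlinarith

lemma vertexOf_sub_one_of_mem_block {n : ℕ} {k : Fin n} {x : ℝ} (hx : x ∈ block k) :
    vertexOf n x - 1 = k := by
  obtain ⟨h1, h2⟩ := mem_block_iff.1 hx
  have : ⌈(n : ℝ) * x⌉ = (k : ℤ) + 1 := by
    rw [Int.ceil_eq_iff]
    push_cast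
    constructor <;> linarith
  unfold vertexOf
  omega

lemma eq_of_mem_block {n : ℕ} {k l : Fin n} {x : ℝ} (hk : x ∈ block k) (hl : x ∈ block l) :
    k = l :=
  Fin.ext ((vertexOf_sub_one_of_mem_block hk).symm.trans (vertexOf_sub_one_of_mem_block hl))

lemma pairwise_disjoint_block {n : ℕ} : Pairwise (Function.onFun Disjoint (block (n := n))) :=
  fun _ _ hkl => Set.disjoint_left.2 fun _ hk hl => hkl (eq_of_mem_block hk hl)

lemma iUnion_block_ae_eq {n : ℕ} (hn : n ≠ 0) :
    (⋃ k : Fin n, block k : Set ℝ) =ᵐ[volume] Set.Icc (0:ℝ) 1 := by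
  refine (Set.iUnion_subset block_subset).eventuallyLE.antisymm ?_
  rw [ae_le_set]
  refine measure_mono_null (t := Set.range fun k : ℕ => (k : ℝ) / n) ?_
    ((Set.countable_range _).measure_zero _)
  rintro x ⟨⟨h0, h1⟩, hx⟩
  have hn' : (0 : ℝ) < n := by exact_mod_cast Nat.pos_of_ne_zero hn
  refine ⟨⌊(n : ℝ) * x⌋₊, ?_⟩
  have hnx : 0 ≤ (n : ℝ) * x := by positivity
  have hf := Nat.floor_le hnx
  have hf' := Nat.lt_floor_add_one ((n : ℝ) * x)
  rw [div_eq_iff hn'.ne', mul_comm x]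
  by_contra hne
  have hlt := lt_of_le_of_ne hf hne
  have hk : ⌊(n : ℝ) * x⌋₊ < n := by
    have : (⌊(n : ℝ) * x⌋₊ : ℝ) < n := hlt.trans_le (mul_le_of_le_one_right hn'.le h1)
    exact_mod_cast this
  exact hx (Set.mem_iUnion.2 ⟨⟨_, hk⟩, mem_block_iff.2 ⟨hlt, hf'⟩⟩)

/-- The rearrangement of `[0,1]` that translates the `k`-th block onto the `τ k`-th one. -/
noncomputable def blockShift {n : ℕ} (τ : Equiv.Perm (Fin n)) (x : ℝ) : ℝ :=
  x + ∑ k, (block k).indicator (fun _ => ((τ k : ℝ) - k) / n) x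

lemma measurable_blockShift {n : ℕ} (τ : Equiv.Perm (Fin n)) : Measurable (blockShift τ) :=
  measurable_id.add (Finset.measurable_sum _ fun k _ =>
    measurable_const.indicator (measurableSet_block k))

lemma blockShift_of_mem {n : ℕ} (τ : Equiv.Perm (Fin n)) {k : Fin n} {x : ℝ} (hx : x ∈ block k) :
    blockShift τ x = x + ((τ k : ℝ) - k) / n := by
  rw [blockShift, Finset.sum_eq_single k]
  · rw [Set.indicator_of_mem hx]
  · intro l _ hl
    exact Set.indicator_of_notMem (fun h => hl (eq_of_mem_block h hx)) _
  · simp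

lemma add_shift_mem_block_iff {n : ℕ} {k l : Fin n} {x : ℝ} :
    x + ((l : ℝ) - k) / n ∈ block l ↔ x ∈ block k := by
  have hn : (0 : ℝ) < n := by exact_mod_cast k.pos
  rw [mem_block_iff, mem_block_iff, mul_add, mul_div_cancel₀ _ hn.ne']
  constructor <;> rintro ⟨h1, h2⟩ <;> constructor <;> linarith

lemma blockShift_mem {n : ℕ} (τ : Equiv.Perm (Fin n)) {k : Fin n} {x : ℝ} (hx : x ∈ block k) :
    blockShift τ x ∈ block (τ k) := by
  rw [blockShift_of_mem τ hx]; exact add_shift_mem_block_iff.2 hx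

lemma blockShift_of_notMem {n : ℕ} (τ : Equiv.Perm (Fin n)) {x : ℝ}
    (hx : ∀ k : Fin n, x ∉ block k) : blockShift τ x = x := by
  simp [blockShift, Set.indicator_of_notMem (hx _)]

lemma blockShift_inv_blockShift {n : ℕ} (τ : Equiv.Perm (Fin n)) (x : ℝ) :
    blockShift τ⁻¹ (blockShift τ x) = x := by
  by_cases h : ∃ k : Fin n, x ∈ block k
  · obtain ⟨k, hk⟩ := h
    rw [blockShift_of_mem τ⁻¹ (blockShift_mem τ hk), blockShift_of_mem τ hk]
    simp
    ring
  · push Not at h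
    rw [blockShift_of_notMem τ h, blockShift_of_notMem τ⁻¹ h]

lemma mapsTo_blockShift {n : ℕ} (τ : Equiv.Perm (Fin n)) :
    Set.MapsTo (blockShift τ) (Set.Icc 0 1) (Set.Icc 0 1) := by
  intro x hx
  by_cases h : ∃ k : Fin n, x ∈ block k
  · obtain ⟨k, hk⟩ := h
    exact block_subset _ (blockShift_mem τ hk)
  · push Not at h
    rwa [blockShift_of_notMem τ h]

lemma measurePreserving_blockShift {n : ℕ} (hn : n ≠ 0) (τ : Equiv.Perm (Fin n)) :
    MeasurePreserving (blockShift τ) (volume.restrict (Set.Icc 0 1))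
      (volume.restrict (Set.Icc 0 1)) := by
  refine ⟨measurable_blockShift τ, ?_⟩
  ext B hB
  rw [Measure.map_apply (measurable_blockShift τ) hB,
    ← Measure.restrict_congr_set (iUnion_block_ae_eq hn),
    Measure.restrict_iUnion pairwise_disjoint_block measurableSet_block,
    Measure.sum_apply _ (measurable_blockShift τ hB), Measure.sum_apply _ hB, tsum_fintype,
    tsum_fintype, ← Equiv.sum_comp τ fun k => volume.restrict (block k) B]
  refine Finset.sum_congr rfl fun k _ => ?_
  rw [Measure.restrict_apply (measurable_blockShift τ hB), Measure.restrict_apply hB,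
    ← measure_preimage_add_right volume (((τ k : ℝ) - k) / n) (B ∩ block (τ k))]
  congr 1
  ext x
  simp only [Set.mem_inter_iff, Set.mem_preimage, add_shift_mem_block_iff]
  exact and_congr_left fun hx => by rw [blockShift_of_mem τ hx]

/-- The measure-preserving bijection of `[0,1]` that permutes the blocks according to `τ`. -/
noncomputable def permBij {n : ℕ} (hn : n ≠ 0) (τ : Equiv.Perm (Fin n)) : MPBij where
  toFun := blockShift τ
  bijOn := Set.InvOn.bijOn (f' := blockShift τ⁻¹)
    ⟨fun x _ => blockShift_inv_blockShift τ x, fun x _ => by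
      simpa using blockShift_inv_blockShift τ⁻¹ x⟩
    (mapsTo_blockShift τ) (mapsTo_blockShift τ⁻¹)
  mp := measurePreserving_blockShift hn τ

lemma setIntegral_of_block_const {n : ℕ} (hn : n ≠ 0) {f : ℝ × ℝ → ℝ} {D : Fin n → Fin n → ℝ}
    (hf : ∀ k l, ∀ x ∈ block k, ∀ y ∈ block l, f (x, y) = D k l) {S T : Set ℝ}
    (hS : MeasurableSet S) (hS' : S ⊆ Set.Icc 0 1) (hT : MeasurableSet T)
    (hT' : T ⊆ Set.Icc 0 1) :
    ∫ p in S ×ˢ T, f p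
      = ∑ k, ∑ l, volume.real (S ∩ block k) * volume.real (T ∩ block l) * D k l := by
  have hae : ∀ {U : Set ℝ}, U ⊆ Set.Icc 0 1 → (⋃ k : Fin n, U ∩ block k : Set ℝ) =ᵐ[volume] U := by
    intro U hU
    have h := (ae_eq_refl U).inter (iUnion_block_ae_eq hn)
    rwa [Set.inter_iUnion, Set.inter_eq_left.2 hU] at h
  have hprod : (⋃ q : Fin n × Fin n, (S ∩ block q.1) ×ˢ (T ∩ block q.2) : Set (ℝ × ℝ))
      =ᵐ[volume] S ×ˢ T := by
    have hU : (⋃ q : Fin n × Fin n, (S ∩ block q.1) ×ˢ (T ∩ block q.2) : Set (ℝ × ℝ))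
        = (⋃ k : Fin n, S ∩ block k) ×ˢ ⋃ k : Fin n, T ∩ block k := by
      ext p
      simp only [Set.mem_iUnion, Set.mem_prod, Prod.exists]
      exact ⟨fun ⟨k, l, hk, hl⟩ => ⟨⟨k, hk⟩, l, hl⟩, fun ⟨⟨k, hk⟩, l, hl⟩ => ⟨k, l, hk, hl⟩⟩
    rw [hU]
    exact Measure.set_prod_ae_eq (hae hS') (hae hT')
  have hpiece : ∀ q : Fin n × Fin n, Set.EqOn f (fun _ => D q.1 q.2)
      ((S ∩ block q.1) ×ˢ (T ∩ block q.2)) :=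
    fun q p hp => hf q.1 q.2 p.1 hp.1.2 p.2 hp.2.2
  have hmeas : ∀ q : Fin n × Fin n, MeasurableSet ((S ∩ block q.1) ×ˢ (T ∩ block q.2)) :=
    fun q => (hS.inter (measurableSet_block _)).prod (hT.inter (measurableSet_block _))
  have hfin : ∀ q : Fin n × Fin n, volume ((S ∩ block q.1) ×ˢ (T ∩ block q.2)) ≠ ⊤ := fun q =>
    ((measure_mono (prod_subset_unitSq (Set.inter_subset_left.trans hS')
      (Set.inter_subset_left.trans hT'))).trans_lt (by simp [volume_unitSq])).ne
  rw [← setIntegral_congr_set hprod, integral_iUnion_fintype hmeas]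
  · rw [Fintype.sum_prod_type]
    refine Finset.sum_congr rfl fun k _ => Finset.sum_congr rfl fun l _ => ?_
    rw [setIntegral_congr_fun (hmeas (k, l)) (hpiece (k, l)), setIntegral_const, smul_eq_mul,
      Measure.volume_eq_prod, measureReal_prod_prod]
  · intro q r hqr
    refine Set.disjoint_left.2 fun p hq hr => hqr (Prod.ext ?_ ?_)
    · exact eq_of_mem_block hq.1.2 hr.1.2
    · exact eq_of_mem_block hq.2.2 hr.2.2
  · intro q
    exact (integrableOn_const (hfin q)).congr_fun (hpiece q).symm (hmeas q)

lemma coe_empMeas {n : ℕ} (hn : n ≠ 0) (x : Fin n → ↥(Set.Icc (0:ℝ) 1)) :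
    (empMeas x : Measure ↥(Set.Icc (0:ℝ) 1)) = empMeasAux x := by
  have h : empMeas x = (⟨empMeasAux x, empMeasAux_isProb hn x⟩ : M01) := dif_neg hn
  rw [h]; rfl

lemma cdfM_empMeas {n : ℕ} (hn : n ≠ 0) (x : Fin n → ↥(Set.Icc (0:ℝ) 1)) (y : ℝ) :
    cdfM (empMeas x) y = (Finset.univ.filter fun i => (x i : ℝ) ≤ y).card / n := by
  have hm : MeasurableSet {t : ↥(Set.Icc (0:ℝ) 1) | (t : ℝ) ≤ y} :=
    measurableSet_le measurable_subtype_coe measurable_const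
  rw [cdfM, coe_empMeas hn, empMeasAux, Measure.smul_apply, Measure.finsetSum_apply]
  simp only [Measure.dirac_apply' _ hm, Set.indicator_apply, Set.mem_ofPred_eq, Pi.one_apply,
    Finset.sum_boole, smul_eq_mul, ENNReal.toReal_mul, ENNReal.toReal_inv, ENNReal.toReal_natCast]
  rw [div_eq_inv_mul]

lemma geninv_empMeas {n : ℕ} {x : Fin n → ↥(Set.Icc (0:ℝ) 1)} {τ : Equiv.Perm (Fin n)}
    (hτ : Monotone (x ∘ τ)) {k : Fin n} {u : ℝ} (hu : u ∈ block k) :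
    geninv (empMeas x) u = x (τ k) := by
  have hn : n ≠ 0 := k.pos.ne'
  have hn' : (0 : ℝ) < n := by exact_mod_cast k.pos
  obtain ⟨h1, h2⟩ := mem_block_iff.1 hu
  have hset : {y | y ∈ Set.Icc (0:ℝ) 1 ∧ u < cdfM (empMeas x) y} = Set.Icc ((x (τ k) : ℝ)) 1 := by
    ext y
    have hcard : (Finset.univ.filter fun i => (x i : ℝ) ≤ y).card
        = (Finset.univ.filter fun j => (x (τ j) : ℝ) ≤ y).card :=
      (Finset.card_equiv τ (by simp)).symm
    have key : u < cdfM (empMeas x) y ↔ (x (τ k) : ℝ) ≤ y := by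
      rw [cdfM_empMeas hn, hcard, lt_div_iff₀' hn']
      constructor
      · intro h
        by_contra! hy
        have hsub : (Finset.univ.filter fun j => (x (τ j) : ℝ) ≤ y) ⊆ Finset.Iio k := by
          intro j hj
          rw [Finset.mem_Iio]
          by_contra! hkj
          have : (x (τ k) : ℝ) ≤ x (τ j) := hτ hkj
          linarith [(Finset.mem_filter.1 hj).2]
        have := Finset.card_le_card hsub
        rw [Fin.card_Iio] at this
        have : ((Finset.univ.filter fun j => (x (τ j) : ℝ) ≤ y).card : ℝ) ≤ k := by
          exact_mod_cast this
        linarith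
      · intro h
        have hsub : Finset.Iic k ⊆ Finset.univ.filter fun j => (x (τ j) : ℝ) ≤ y := by
          intro j hj
          rw [Finset.mem_Iic] at hj
          have : (x (τ j) : ℝ) ≤ x (τ k) := hτ hj
          exact Finset.mem_filter.2 ⟨Finset.mem_univ _, this.trans h⟩
        have := Finset.card_le_card hsub
        rw [Fin.card_Iic] at this
        have : (k : ℝ) + 1 ≤ (Finset.univ.filter fun j => (x (τ j) : ℝ) ≤ y).card := by
          exact_mod_cast this
        linarith
    rw [Set.mem_ofPred_eq, key, Set.mem_Icc, Set.mem_Icc]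
    exact ⟨fun h => ⟨h.2, h.1.2⟩, fun h => ⟨⟨(x (τ k)).2.1.trans h.1, h.2⟩, h.1⟩⟩
  rw [geninv, hset, csInf_Icc (x (τ k)).2.2]

/-- The edge probabilities given the types. -/
noncomputable def edgeProb (Hfun : ℝ → ℝ → M01 → ℝ) {n : ℕ} (x : Fin n → ↥(Set.Icc (0:ℝ) 1)) (i j : Fin n) :
    ℝ := Hfun (x i) (x j) (empMeas x)

lemma inducedGraphon_empMeas (Hfun : ℝ → ℝ → M01 → ℝ) {n : ℕ} {x : Fin n → ↥(Set.Icc (0:ℝ) 1)}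
    {τ : Equiv.Perm (Fin n)} (hτ : Monotone (x ∘ τ)) {k l : Fin n} {u v : ℝ} (hu : u ∈ block k)
    (hv : v ∈ block l) :
    inducedGraphon Hfun (empMeas x) u v = edgeProb Hfun x (τ k) (τ l) := by
  rw [inducedGraphon, geninv_empMeas hτ hu, geninv_empMeas hτ hv, edgeProb]

open Classical in
lemma empGraphon_of_mem_block {n : ℕ} (A : Fin n → Fin n → Prop) {k l : Fin n} {u v : ℝ}
    (hu : u ∈ block k) (hv : v ∈ block l) :
    empGraphon A u v = if A k l then 1 else 0 := by
  have h1 := vertexOf_sub_one_of_mem_block hu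
  have h2 := vertexOf_sub_one_of_mem_block hv
  simp [empGraphon, h1, h2]

lemma measurable_vertexOf (n : ℕ) : Measurable (vertexOf n) :=
  (measurable_from_top (f := Int.toNat)).comp
    (Int.measurable_ceil.comp (measurable_const.mul measurable_id))

lemma isGraphon_empGraphon {n : ℕ} {A : Fin n → Fin n → Prop} (hA : ∀ i j, A i j → A j i) :
    IsGraphon (empGraphon A) := by
  classical
  refine ⟨?_, fun x y => ?_, fun x y => ?_⟩
  · let φ : ℕ × ℕ → ℝ := fun q =>
      if h : q.1 - 1 < n ∧ q.2 - 1 < n then (if A ⟨q.1 - 1, h.1⟩ ⟨q.2 - 1, h.2⟩ then 1 else 0)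
      else 0
    exact (measurable_of_countable φ).comp
      (((measurable_vertexOf n).comp measurable_fst).prodMk
        ((measurable_vertexOf n).comp measurable_snd))
  · unfold empGraphon
    by_cases h : vertexOf n x - 1 < n ∧ vertexOf n y - 1 < n
    · rw [dif_pos h, dif_pos h.symm]
      exact if_congr ⟨hA _ _, hA _ _⟩ rfl rfl
    · rw [dif_neg h, dif_neg (mt And.symm h)]
  · unfold empGraphon
    split_ifs <;> simp

lemma irgtAdj_symm {Hfun : ℝ → ℝ → M01 → ℝ} (Hsymm : ∀ a b F, Hfun a b F = Hfun b a F) {n : ℕ}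
    (x : Fin n → ↥(Set.Icc (0:ℝ) 1)) (u : Fin n × Fin n → ℝ) (i j : Fin n)
    (h : irgtAdj Hfun x u i j) : irgtAdj Hfun x u j i :=
  ⟨h.1.symm, by rw [min_comm, max_comm, Hsymm]; exact h.2⟩

/-- Outside the deviation event, the empirical graphon is, after reordering the vertices by their
types, close to the reference graphon induced by the empirical type distribution. -/
lemma exists_cutClose_empGraphon {Hfun : ℝ → ℝ → M01 → ℝ}
    (Hsymm : ∀ a b F, Hfun a b F = Hfun b a F) (Hrange : ∀ a b F, Hfun a b F ∈ Set.Icc (0:ℝ) 1)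
    {n : ℕ} (hn : n ≠ 0) (x : Fin n → ↥(Set.Icc (0:ℝ) 1)) {u : Fin n × Fin n → ℝ} {ε : ℝ}
    (hu : u ∉ deviationSet ε (edgeProb Hfun x)) :
    ∃ σ : MPBij, CutClose (2 * ε + 1 / n) (relabel σ (empGraphon (irgtAdj Hfun x u)))
      (inducedGraphon Hfun (empMeas x)) := by
  classical
  set τ := Tuple.sort x with hτdef
  have hτ : Monotone (x ∘ τ) := Tuple.monotone_sort x
  refine ⟨permBij hn τ, fun S T hS hS' hT hT' => ?_⟩
  set D : Fin n → Fin n → ℝ := fun i j =>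
    (if i ≠ j ∧ u (min i j, max i j) ≤ edgeProb Hfun x i j then (1:ℝ) else 0)
      - edgeProb Hfun x i j with hD
  rw [setIntegral_of_block_const hn (D := fun k l => D (τ k) (τ l)) ?_ hS hS' hT hT']
  · have hmem : ∀ {U : Set ℝ} (k : Fin n),
        volume.real (U ∩ block k) ∈ Set.Icc 0 (1 / (n : ℝ)) := fun k =>
      ⟨measureReal_nonneg, volume_block k ▸ measureReal_mono Set.inter_subset_right
        (by simp [block])⟩
    refine (abs_bilinear_le_of_forall_finset (c := 1 / (n : ℝ)) (M := 2 * (ε * n ^ 2) + n)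
      (by positivity) (fun k => hmem k) (fun k => hmem k) fun P Q => ?_).trans (le_of_eq ?_)
    · have h := abs_sum_adj_sub_le (p := edgeProb Hfun x) (fun i j => Hrange _ _ _)
        (fun i j => Hsymm _ _ _) hu (P.map τ.toEmbedding) (Q.map τ.toEmbedding)
      simp only [Finset.sum_map] at h
      exact h
    · have hn' : (n : ℝ) ≠ 0 := by exact_mod_cast hn
      field_simp
  · intro k l a ha b hb
    have h1 : relabel (permBij hn τ) (empGraphon (irgtAdj Hfun x u)) a b
        = if irgtAdj Hfun x u (τ k) (τ l) then 1 else 0 :=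
      empGraphon_of_mem_block _ (blockShift_mem τ ha) (blockShift_mem τ hb)
    dsimp only
    rw [h1, inducedGraphon_empMeas Hfun hτ ha hb]
    exact congrArg (· - _) (if_congr Iff.rfl rfl rfl)

lemma continuous_empMeas {n : ℕ} (hn : n ≠ 0) :
    Continuous (empMeas : (Fin n → ↥(Set.Icc (0:ℝ) 1)) → M01) := by
  rw [continuous_iff_continuousAt]
  intro x₀
  rw [ContinuousAt, ProbabilityMeasure.tendsto_iff_forall_integral_tendsto]
  intro f
  have h : ∀ x : Fin n → ↥(Set.Icc (0:ℝ) 1),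
      ∫ t, f t ∂(empMeas x : Measure ↥(Set.Icc (0:ℝ) 1)) = (n : ℝ)⁻¹ * ∑ i, f (x i) := by
    intro x
    rw [coe_empMeas hn, empMeasAux, integral_smul_measure, integral_finsetSum_measure]
    · simp
    · exact fun i _ => f.integrable _
  simp_rw [h]
  have hc : Continuous fun x : Fin n → ↥(Set.Icc (0:ℝ) 1) => (n : ℝ)⁻¹ * ∑ i, f (x i) := by
    fun_prop
  exact hc.tendsto x₀

lemma continuous_edgeProb {Hfun : ℝ → ℝ → M01 → ℝ}
    (hGraphon : ∀ F : M01, IsGraphon (inducedGraphon Hfun F))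
    (hcont : ∀ F₀ : M01,
      Tendsto (fun F => L1dist (inducedGraphon Hfun F) (inducedGraphon Hfun F₀))
        (nhds F₀) (nhds 0))
    {n : ℕ} (hn : n ≠ 0) (i j : Fin n) :
    Continuous fun x : Fin n → ↥(Set.Icc (0:ℝ) 1) => edgeProb Hfun x i j := by
  have hn' : (n : ℝ) ≠ 0 := by exact_mod_cast hn
  let M : Equiv.Perm (Fin n) → Set (Fin n → ↥(Set.Icc (0:ℝ) 1)) := fun τ => {x | Monotone (x ∘ τ)}
  refine LocallyFinite.continuous (f := M) (locallyFinite_of_finite _) ?_ ?_ ?_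
  · exact Set.eq_univ_of_forall fun x => Set.mem_iUnion.2 ⟨Tuple.sort x, Tuple.monotone_sort x⟩
  · intro τ
    simp only [M, Monotone, Set.ofPred_forall]
    exact isClosed_iInter fun a => isClosed_iInter fun b => isClosed_iInter fun _ =>
      isClosed_le (continuous_apply _) (continuous_apply _)
  · intro τ
    have hblock : ∀ k l : Fin n, block k ×ˢ block l ⊆ unitSq := fun k l =>
      prod_subset_unitSq (block_subset k) (block_subset l)
    have hG : Continuous fun F : M01 =>
        ∫ p in block (τ⁻¹ i) ×ˢ block (τ⁻¹ j), inducedGraphon Hfun F p.1 p.2 := by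
      rw [continuous_iff_continuousAt]
      intro F₀
      rw [ContinuousAt, tendsto_iff_dist_tendsto_zero]
      refine squeeze_zero (fun _ => dist_nonneg) (fun F => ?_) (hcont F₀)
      rw [Real.dist_eq, ← integral_sub ((hGraphon F).integrableOn (hblock _ _))
        ((hGraphon F₀).integrableOn (hblock _ _))]
      exact abs_setIntegral_sub_le_L1dist (hGraphon F) (hGraphon F₀) (hblock _ _)
    refine ((hG.comp (continuous_empMeas hn)).const_smul ((n : ℝ) ^ 2)).continuousOn.congr ?_
    intro x hx
    have hval : Set.EqOn (fun p : ℝ × ℝ => inducedGraphon Hfun (empMeas x) p.1 p.2)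
        (fun _ => edgeProb Hfun x i j) (block (τ⁻¹ i) ×ˢ block (τ⁻¹ j)) := by
      intro p hp
      simpa using inducedGraphon_empMeas Hfun hx hp.1 hp.2
    change edgeProb Hfun x i j = (n : ℝ) ^ 2 •
      ∫ p in block (τ⁻¹ i) ×ˢ block (τ⁻¹ j), inducedGraphon Hfun (empMeas x) p.1 p.2
    rw [setIntegral_congr_fun ((measurableSet_block _).prod (measurableSet_block _)) hval,
      setIntegral_const, Measure.volume_eq_prod, measureReal_prod_prod, volume_block, volume_block]
    simp only [smul_eq_mul]
    field_simp

/-- The event that the empirical graphon deviates a lot from its mean given the types. -/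
def typedDeviationSet (Hfun : ℝ → ℝ → M01 → ℝ) (n : ℕ) (ε : ℝ) :
    Set ((Fin n → ↥(Set.Icc (0:ℝ) 1)) × (Fin n × Fin n → ℝ)) :=
  {ω | ω.2 ∈ deviationSet ε (edgeProb Hfun ω.1)}

lemma measure_typedDeviationSet_le {Hfun : ℝ → ℝ → M01 → ℝ}
    (Hrange : ∀ a b F, Hfun a b F ∈ Set.Icc (0:ℝ) 1)
    (hGraphon : ∀ F : M01, IsGraphon (inducedGraphon Hfun F))
    (hcont : ∀ F₀ : M01,
      Tendsto (fun F => L1dist (inducedGraphon Hfun F) (inducedGraphon Hfun F₀))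
        (nhds F₀) (nhds 0))
    {n : ℕ} (hn : n ≠ 0) {ε : ℝ} (hε : 0 ≤ ε) (μ : Measure (Fin n → ↥(Set.Icc (0:ℝ) 1)))
    [IsProbabilityMeasure μ] :
    (μ.prod (cubeMeasure n)) (typedDeviationSet Hfun n ε)
      ≤ ENNReal.ofReal (4 ^ n * (2 * Real.exp (-(ε ^ 2 * n ^ 2 / 2)))) := by
  have hmeas : MeasurableSet (typedDeviationSet Hfun n ε) := by
    have h : typedDeviationSet Hfun n ε = ⋃ (S : Finset (Fin n)) (T : Finset (Fin n)),
        {ω | ε * n ^ 2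
          ≤ |∑ e ∈ upperPairs S T, edgeDev (edgeProb Hfun ω.1 e.1 e.2) (ω.2 e)|} := by
      ext ω; simp [typedDeviationSet, deviationSet]
    rw [h]
    refine MeasurableSet.iUnion fun S => MeasurableSet.iUnion fun T =>
      measurableSet_le measurable_const ?_
    refine continuous_abs.measurable.comp (Finset.measurable_sum _ fun e _ => ?_)
    exact measurable_edgeDev.comp
      (((continuous_edgeProb hGraphon hcont hn e.1 e.2).measurable.comp measurable_fst).prodMk
        ((measurable_pi_apply e).comp measurable_snd))
  rw [Measure.prod_apply hmeas]
  refine (lintegral_mono fun x => cubeMeasure_deviationSet_le hε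
    (p := edgeProb Hfun x) fun i j => Hrange _ _ _).trans ?_
  simp

lemma eventually_deviation_bound_le {ℓ : ℕ → ℝ} (hrate : ℓ =o[atTop] binom2) {ε : ℝ} (hε : 0 < ε)
    (c : ℝ) :
    ∀ᶠ n : ℕ in atTop, 4 ^ n * (2 * Real.exp (-(ε ^ 2 * n ^ 2 / 2))) ≤ Real.exp (c * ℓ n) := by
  have hδ : 0 < ε ^ 2 / (4 * (|c| + 1)) := by positivity
  filter_upwards [hrate.bound hδ, tendsto_natCast_atTop_atTop.eventually_ge_atTop (8 / ε ^ 2),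
    eventually_ge_atTop 1] with n h1 h2 h3
  have hn : (1 : ℝ) ≤ n := by exact_mod_cast h3
  have hb : ‖binom2 n‖ ≤ n ^ 2 / 2 := by
    rw [Real.norm_eq_abs, binom2, abs_of_nonneg (by nlinarith)]
    nlinarith
  have hcl : |c * ℓ n| ≤ ε ^ 2 * n ^ 2 / 8 := by
    have h4 : |ℓ n| ≤ ε ^ 2 / (4 * (|c| + 1)) * (n ^ 2 / 2) :=
      h1.trans (mul_le_mul_of_nonneg_left hb hδ.le)
    calc |c * ℓ n| = |c| * |ℓ n| := abs_mul _ _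
      _ ≤ (|c| + 1) * (ε ^ 2 / (4 * (|c| + 1)) * (n ^ 2 / 2)) := by gcongr; linarith
      _ = ε ^ 2 * n ^ 2 / 8 := by field_simp; norm_num
  have h8 : 8 ≤ ε ^ 2 * n := by rwa [div_le_iff₀' (by positivity)] at h2
  have hexp1 : 2 ≤ Real.exp 1 := by linarith [Real.add_one_le_exp (1:ℝ)]
  have h4n : (4 : ℝ) ^ n ≤ Real.exp (2 * n) := by
    rw [mul_comm, Real.exp_nat_mul]
    gcongr
    calc (4 : ℝ) = 2 * 2 := by norm_num
      _ ≤ Real.exp 1 * Real.exp 1 := by gcongr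
      _ = Real.exp 2 := by rw [← Real.exp_add]; norm_num
  have h2n : 2 ≤ Real.exp n := hexp1.trans (Real.exp_le_exp.2 hn)
  calc 4 ^ n * (2 * Real.exp (-(ε ^ 2 * n ^ 2 / 2)))
      ≤ Real.exp (2 * n) * (Real.exp n * Real.exp (-(ε ^ 2 * n ^ 2 / 2))) := by gcongr
    _ = Real.exp (2 * n + (n + -(ε ^ 2 * n ^ 2 / 2))) := by rw [Real.exp_add, Real.exp_add]
    _ ≤ Real.exp (c * ℓ n) := by
      rw [Real.exp_le_exp]
      have := (abs_le.1 hcl).1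
      nlinarith

/-- The type distributions whose induced graphon is `ε`-close to a relabelled element of `C`. -/
def approxTypes (Hfun : ℝ → ℝ → M01 → ℝ) (C : Set (ℝ → ℝ → ℝ)) (ε : ℝ) : Set M01 :=
  {F | ∃ h ∈ C, ∃ σ : MPBij, CutClose ε (relabel σ h) (inducedGraphon Hfun F)}

lemma approxTypes_mono (Hfun : ℝ → ℝ → M01 → ℝ) (C : Set (ℝ → ℝ → ℝ)) {ε δ : ℝ} (h : ε ≤ δ) :
    approxTypes Hfun C ε ⊆ approxTypes Hfun C δ :=
  fun _ ⟨f, hf, σ, hσ⟩ => ⟨f, hf, σ, hσ.mono h⟩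

lemma inducedGraphon_mem_of_forall_mem_closure {Hfun : ℝ → ℝ → M01 → ℝ}
    (hGraphon : ∀ F : M01, IsGraphon (inducedGraphon Hfun F))
    (hcont : ∀ F₀ : M01,
      Tendsto (fun F => L1dist (inducedGraphon Hfun F) (inducedGraphon Hfun F₀))
        (nhds F₀) (nhds 0))
    {C : Set (ℝ → ℝ → ℝ)} (hC : DeltaClosedIn C) {F : M01}
    (hF : ∀ ε > 0, F ∈ closure (approxTypes Hfun C ε)) : inducedGraphon Hfun F ∈ C := by
  by_contra hFC
  obtain ⟨η, hη, hηC⟩ := hC.2 _ (hGraphon F) hFC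
  have hη4 : 0 < η / 4 := by positivity
  obtain ⟨F', hF', h, hhC, σ, hσ⟩ := mem_closure_iff_nhds.1 (hF (η / 4) hη4) _
    ((hcont F).eventually (gt_mem_nhds hη4))
  have hclose := hσ.trans ((hC.1 hhC : IsGraphon h).relabel σ) (hGraphon F') (hGraphon F)
    (cutClose_of_L1dist_le (hGraphon F') (hGraphon F) hF'.le)
  exact hηC h (hC.1 hhC) (hclose.cutMetric_le.trans_lt (by linarith)) hhC

lemma exists_pos_forall_closure_approxTypes_lt {Hfun : ℝ → ℝ → M01 → ℝ}
    (hGraphon : ∀ F : M01, IsGraphon (inducedGraphon Hfun F))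
    (hcont : ∀ F₀ : M01,
      Tendsto (fun F => L1dist (inducedGraphon Hfun F) (inducedGraphon Hfun F₀))
        (nhds F₀) (nhds 0))
    {K : M01 → ℝ≥0∞} (hK : LowerSemicontinuous K)
    {C : Set (ℝ → ℝ → ℝ)} (hC : DeltaClosedIn C) {y : ℝ≥0∞}
    (hy : ∀ F, inducedGraphon Hfun F ∈ C → y < K F) :
    ∃ ε > 0, ∀ F ∈ closure (approxTypes Hfun C ε), y < K F := by
  by_contra! hne
  let Z : ℕ → Set M01 := fun m => closure (approxTypes Hfun C (1 / ((m : ℝ) + 1))) ∩ K ⁻¹' Set.Iic y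
  have hZ : ∀ m, IsClosed (Z m) := fun m => isClosed_closure.inter (hK.isClosed_preimage y)
  obtain ⟨F, hF⟩ := IsCompact.nonempty_iInter_of_sequence_nonempty_isCompact_isClosed Z
    (fun m => Set.inter_subset_inter_left _ (closure_mono (approxTypes_mono Hfun C (by
      push_cast; gcongr; linarith))))
    (fun m => hne _ (by positivity)) (hZ 0).isCompact hZ
  rw [Set.mem_iInter] at hF
  refine (hy F (inducedGraphon_mem_of_forall_mem_closure hGraphon hcont hC fun ε hε => ?_)).not_ge
    (hF 0).2
  obtain ⟨m, hm⟩ := exists_nat_one_div_lt hε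
  exact closure_mono (approxTypes_mono Hfun C hm.le) (hF m).1

lemma eventually_exists_cutClose {Hfun : ℝ → ℝ → M01 → ℝ}
    (Hsymm : ∀ a b F, Hfun a b F = Hfun b a F) (Hrange : ∀ a b F, Hfun a b F ∈ Set.Icc (0:ℝ) 1)
    {ε : ℝ} (hε : 0 < ε) :
    ∀ᶠ n : ℕ in atTop, ∀ ω ∉ typedDeviationSet Hfun n (ε / 4), ∃ σ : MPBij,
      CutClose ε (relabel σ (empGraphon (irgtAdj Hfun ω.1 ω.2)))
        (inducedGraphon Hfun (empMeas ω.1)) := by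
  filter_upwards [tendsto_natCast_atTop_atTop.eventually_ge_atTop (2 / ε), eventually_ne_atTop 0]
    with n h1 hn ω hω
  obtain ⟨σ, hσ⟩ := exists_cutClose_empGraphon Hsymm Hrange hn ω.1 hω
  refine ⟨σ, hσ.mono ?_⟩
  have hn' : (0 : ℝ) < n := by exact_mod_cast Nat.pos_of_ne_zero hn
  have h2 : 2 ≤ ε * n := by rwa [div_le_iff₀' hε] at h1
  have h3 : 1 / (n : ℝ) ≤ ε / 2 := by
    rw [div_le_iff₀ hn']; linarith
  linarith

lemma eventually_measure_typedDeviationSet_le {Hfun : ℝ → ℝ → M01 → ℝ}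
    (Hrange : ∀ a b F, Hfun a b F ∈ Set.Icc (0:ℝ) 1)
    (hGraphon : ∀ F : M01, IsGraphon (inducedGraphon Hfun F))
    (ν : ∀ n : ℕ, Measure (Fin n → ↥(Set.Icc (0:ℝ) 1))) [∀ n, IsProbabilityMeasure (ν n)]
    {ℓ : ℕ → ℝ}
    (hcont : ∀ F₀ : M01,
      Tendsto (fun F => L1dist (inducedGraphon Hfun F) (inducedGraphon Hfun F₀))
        (nhds F₀) (nhds 0))
    (hrate : ℓ =o[atTop] binom2) {ε : ℝ} (hε : 0 < ε) (c : ℝ) :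
    ∀ᶠ n : ℕ in atTop, ((ν n).prod (cubeMeasure n)) (typedDeviationSet Hfun n ε)
      ≤ ENNReal.ofReal (Real.exp (c * ℓ n)) := by
  filter_upwards [eventually_deviation_bound_le hrate hε c, eventually_ne_atTop 0] with n h1 hn
  exact (measure_typedDeviationSet_le Hrange hGraphon hcont hn hε.le (ν n)).trans
    (ENNReal.ofReal_le_ofReal h1)

lemma prod_preimage_fst {α β : Type*} [MeasurableSpace α] [MeasurableSpace β] (μ : Measure α)
    (κ : Measure β) [SFinite μ] [IsProbabilityMeasure κ] (A : Set α) :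
    (μ.prod κ) {ω | ω.1 ∈ A} = μ A := by
  have h : {ω : α × β | ω.1 ∈ A} = A ×ˢ Set.univ := by ext; simp
  rw [h, Measure.prod_prod, measure_univ, mul_one]

lemma graphonLDP_upper {Hfun : ℝ → ℝ → M01 → ℝ}
    (Hsymm : ∀ a b F, Hfun a b F = Hfun b a F)
    (Hrange : ∀ a b F, Hfun a b F ∈ Set.Icc (0:ℝ) 1)
    (hGraphon : ∀ F : M01, IsGraphon (inducedGraphon Hfun F))
    (ν : ∀ n : ℕ, Measure (Fin n → ↥(Set.Icc (0:ℝ) 1)))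
    [∀ n, IsProbabilityMeasure (ν n)]
    {ℓ : ℕ → ℝ} {K : M01 → ℝ≥0∞} (hK : LowerSemicontinuous K)
    (hLDPtypes : SatisfiesLDP (fun n => ν n) (fun n x => empMeas x) ℓ K)
    (hcont : ∀ F₀ : M01,
      Tendsto (fun F => L1dist (inducedGraphon Hfun F) (inducedGraphon Hfun F₀))
        (nhds F₀) (nhds 0))
    (hrate : ℓ =o[atTop] binom2) {C : Set (ℝ → ℝ → ℝ)} (hC : DeltaClosedIn C) :
    atTop.limsup (fun n => (((ℓ n)⁻¹ : ℝ) : EReal) *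
        ENNReal.log (((ν n).prod (cubeMeasure n))
          ((fun ω => empGraphon (irgtAdj Hfun ω.1 ω.2)) ⁻¹' C)))
      ≤ -(⨅ h ∈ C, ((⨅ F ∈ {F : M01 | cutMetric (inducedGraphon Hfun F) h = 0}, K F : ℝ≥0∞) :
        EReal)) := by
  have hℓ := hLDPtypes.1
  refine EReal.le_of_forall_lt_iff_le.1 fun c hc => ?_
  rcases le_or_gt 0 c with hc0 | hc0
  · refine limsup_le_of_eventually_le_exp hℓ ?_
    filter_upwards [hℓ.eventually_ge_atTop 0] with n hn
    refine prob_le_one.trans ?_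
    rw [← ENNReal.ofReal_one]
    exact ENNReal.ofReal_le_ofReal (Real.one_le_exp (mul_nonneg hc0 hn))
  obtain ⟨c₁, h1, h1c⟩ := EReal.lt_iff_exists_real_btwn.1 hc
  rw [EReal.coe_lt_coe_iff] at h1c
  obtain ⟨c₂, h12, h2c⟩ := exists_between h1c
  have hy : ∀ F, inducedGraphon Hfun F ∈ C → ENNReal.ofReal (-c₁) < K F := by
    intro F hF
    have hle : (⨅ h ∈ C, ((⨅ F ∈ {F : M01 | cutMetric (inducedGraphon Hfun F) h = 0}, K F : ℝ≥0∞) :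
        EReal)) ≤ K F :=
      (iInf₂_le _ hF).trans (EReal.coe_ennreal_le_coe_ennreal_iff.2
        (iInf₂_le F (cutMetric_self _)))
    have h2 := (EReal.neg_lt_comm.1 h1).trans_le hle
    rw [← EReal.coe_ennreal_lt_coe_ennreal_iff, EReal.coe_ennreal_ofReal,
      max_eq_left (by linarith)]
    exact_mod_cast h2
  obtain ⟨ε, hε, hεK⟩ := exists_pos_forall_closure_approxTypes_lt hGraphon hcont hK hC hy
  have hup : atTop.limsup (fun n => (((ℓ n)⁻¹ : ℝ) : EReal) *
      ENNReal.log (ν n ((fun x => empMeas x) ⁻¹' closure (approxTypes Hfun C ε)))) < c₂ := by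
    refine (hLDPtypes.2.1 _ isClosed_closure).trans_lt ?_
    refine lt_of_le_of_lt ?_ (EReal.coe_lt_coe_iff.2 h12)
    rw [EReal.neg_le]
    refine le_iInf₂ fun F hF => ?_
    have h2 := EReal.coe_ennreal_le_coe_ennreal_iff.2 (hεK F hF).le
    rw [EReal.coe_ennreal_ofReal, max_eq_left (by linarith)] at h2
    exact_mod_cast h2
  refine limsup_le_of_eventually_le_exp hℓ ?_
  filter_upwards [eventually_le_exp_of_limsup_lt hℓ hup,
    eventually_measure_typedDeviationSet_le Hrange hGraphon ν hcont hrate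
      (show 0 < ε / 4 by positivity) c₂,
    eventually_exists_cutClose Hsymm Hrange hε, eventually_two_mul_exp_le hℓ h2c]
    with n h3 h4 h5 h6
  have hsub : (fun ω : (Fin n → ↥(Set.Icc (0:ℝ) 1)) × (Fin n × Fin n → ℝ) =>
      empGraphon (irgtAdj Hfun ω.1 ω.2)) ⁻¹' C
      ⊆ {ω | ω.1 ∈ (fun x => empMeas x) ⁻¹' closure (approxTypes Hfun C ε)}
        ∪ typedDeviationSet Hfun n (ε / 4) := by
    intro ω hω
    by_cases hbad : ω ∈ typedDeviationSet Hfun n (ε / 4)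
    · exact Or.inr hbad
    · obtain ⟨σ, hσ⟩ := h5 ω hbad
      exact Or.inl (subset_closure ⟨_, hω, σ, hσ⟩)
  calc _ ≤ _ := measure_mono hsub
    _ ≤ _ := measure_union_le _ _
    _ ≤ ENNReal.ofReal (Real.exp (c₂ * ℓ n)) + ENNReal.ofReal (Real.exp (c₂ * ℓ n)) := by
      rw [prod_preimage_fst]
      exact add_le_add h3 h4
    _ = ENNReal.ofReal (2 * Real.exp (c₂ * ℓ n)) := by
      rw [← ENNReal.ofReal_add (Real.exp_nonneg _) (Real.exp_nonneg _), two_mul]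
    _ ≤ _ := ENNReal.ofReal_le_ofReal h6

lemma graphonLDP_lower {Hfun : ℝ → ℝ → M01 → ℝ}
    (Hsymm : ∀ a b F, Hfun a b F = Hfun b a F)
    (Hrange : ∀ a b F, Hfun a b F ∈ Set.Icc (0:ℝ) 1)
    (hGraphon : ∀ F : M01, IsGraphon (inducedGraphon Hfun F))
    (ν : ∀ n : ℕ, Measure (Fin n → ↥(Set.Icc (0:ℝ) 1)))
    [∀ n, IsProbabilityMeasure (ν n)]
    {ℓ : ℕ → ℝ} {K : M01 → ℝ≥0∞}
    (hLDPtypes : SatisfiesLDP (fun n => ν n) (fun n x => empMeas x) ℓ K)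
    (hcont : ∀ F₀ : M01,
      Tendsto (fun F => L1dist (inducedGraphon Hfun F) (inducedGraphon Hfun F₀))
        (nhds F₀) (nhds 0))
    (hrate : ℓ =o[atTop] binom2) {O : Set (ℝ → ℝ → ℝ)} (hO : DeltaOpenIn O) {F : M01}
    (hF : inducedGraphon Hfun F ∈ O) :
    -(K F : EReal) ≤ atTop.liminf (fun n => (((ℓ n)⁻¹ : ℝ) : EReal) *
        ENNReal.log (((ν n).prod (cubeMeasure n))
          ((fun ω => empGraphon (irgtAdj Hfun ω.1 ω.2)) ⁻¹' O))) := by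
  have hℓ := hLDPtypes.1
  refine EReal.ge_of_forall_gt_iff_ge.1 fun c hc => ?_
  obtain ⟨c₁, hc1, h1⟩ := EReal.lt_iff_exists_real_btwn.1 hc
  rw [EReal.coe_lt_coe_iff] at hc1
  obtain ⟨η, hη, hηO⟩ := hO.2 _ hF
  have hη4 : 0 < η / 4 := by positivity
  obtain ⟨U, hU, hUopen, hFU⟩ := eventually_nhds_iff.1
    ((hcont F).eventually (gt_mem_nhds hη4))
  have hlow : c₁ < atTop.liminf (fun n => (((ℓ n)⁻¹ : ℝ) : EReal) *
      ENNReal.log (ν n ((fun x => empMeas x) ⁻¹' U))) :=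
    h1.trans_le ((EReal.neg_le_neg_iff.2 (iInf₂_le F hFU)).trans (hLDPtypes.2.2 U hUopen))
  refine le_liminf_of_eventually_exp_le hℓ ?_
  filter_upwards [eventually_exp_le_of_lt_liminf hℓ hlow,
    eventually_measure_typedDeviationSet_le Hrange hGraphon ν hcont hrate
      (show 0 < η / 4 / 4 by positivity) c,
    eventually_exists_cutClose Hsymm Hrange hη4, eventually_two_mul_exp_le hℓ hc1]
    with n h3 h4 h5 h6
  have hsub : {ω : (Fin n → ↥(Set.Icc (0:ℝ) 1)) × (Fin n × Fin n → ℝ) |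
        ω.1 ∈ (fun x => empMeas x) ⁻¹' U}
      ⊆ (fun ω => empGraphon (irgtAdj Hfun ω.1 ω.2)) ⁻¹' O
        ∪ typedDeviationSet Hfun n (η / 4 / 4) := by
    intro ω hω
    by_cases hbad : ω ∈ typedDeviationSet Hfun n (η / 4 / 4)
    · exact Or.inr hbad
    · obtain ⟨σ, hσ⟩ := h5 ω hbad
      have hemp : IsGraphon (empGraphon (irgtAdj Hfun ω.1 ω.2)) :=
        isGraphon_empGraphon (irgtAdj_symm Hsymm ω.1 ω.2)
      have hclose := hσ.trans (hemp.relabel σ) (hGraphon _) (hGraphon F)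
        (cutClose_of_L1dist_le (hGraphon _) (hGraphon F) (hU _ hω).le)
      exact Or.inl (hηO _ hemp (hclose.cutMetric_le.trans_lt (by linarith)))
  have hle := (measure_mono hsub).trans
    (measure_union_le (μ := (ν n).prod (cubeMeasure n)) _ _)
  rw [prod_preimage_fst] at hle
  have h7 : ENNReal.ofReal (Real.exp (c * ℓ n)) + ENNReal.ofReal (Real.exp (c * ℓ n))
      ≤ ((ν n).prod (cubeMeasure n)) ((fun ω => empGraphon (irgtAdj Hfun ω.1 ω.2)) ⁻¹' O)
        + ENNReal.ofReal (Real.exp (c * ℓ n)) := by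
    rw [← ENNReal.ofReal_add (Real.exp_nonneg _) (Real.exp_nonneg _), ← two_mul]
    exact (ENNReal.ofReal_le_ofReal h6).trans (h3.trans (hle.trans (by gcongr)))
  exact (ENNReal.add_le_add_iff_right ENNReal.ofReal_ne_top).1 h7

lemma EReal.le_coe_iInf₂ {α : Type*} {s : Set α} {f : α → ℝ≥0∞} {a : EReal}
    (h : ∀ x ∈ s, a ≤ (f x : EReal)) : a ≤ ((⨅ x ∈ s, f x : ℝ≥0∞) : EReal) := by
  rcases le_total a 0 with ha | ha
  · exact ha.trans (EReal.coe_ennreal_nonneg _)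
  · rw [← EReal.coe_toENNReal ha, EReal.coe_ennreal_le_coe_ennreal_iff]
    refine le_iInf₂ fun x hx => ?_
    rw [← EReal.coe_ennreal_le_coe_ennreal_iff, EReal.coe_toENNReal ha]
    exact h x hx

/-- **Theorem 2.4(i)** (LDP for IRGTs, vertex-level fluctuations).
If (a) the empirical type distributions `F_n` satisfy the LDP on `M([0,1])` with speed `ℓ(n)`
and lower-semicontinuous rate function `K`, (b) `F ↦ g^{[F]}` is continuous from `M([0,1])`
(weak topology) to `(W, ‖·‖_{L¹})`, and (c) `ℓ(n) = o(n(n-1)/2)`, then the laws of the classes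
`h̃^{G_n}` of the empirical graphons of the IRGT satisfy the LDP on `(W̃, δ_□)` with speed
`ℓ(n)` and rate function `J(h̃) = inf{K(F) : g̃^{[F]} = h̃}`. -/
theorem statement0
    (Hfun : ℝ → ℝ → M01 → ℝ)
    (Hsymm : ∀ a b F, Hfun a b F = Hfun b a F)
    (Hrange : ∀ a b F, Hfun a b F ∈ Set.Icc (0:ℝ) 1)
    (hGraphon : ∀ F : M01, IsGraphon (inducedGraphon Hfun F))
    (ν : ∀ n : ℕ, Measure (Fin n → ↥(Set.Icc (0:ℝ) 1)))
    [∀ n, IsProbabilityMeasure (ν n)]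
    (ℓ : ℕ → ℝ) (K : M01 → ℝ≥0∞) (hK : LowerSemicontinuous K)
    (hLDPtypes : SatisfiesLDP (fun n => ν n) (fun n x => empMeas x) ℓ K)
    (hcont : ∀ F₀ : M01,
      Tendsto (fun F => L1dist (inducedGraphon Hfun F) (inducedGraphon Hfun F₀))
        (nhds F₀) (nhds 0))
    (hrate : ℓ =o[atTop] binom2) :
    GraphonLDP (fun n => (ν n).prod (cubeMeasure n))
      (fun n ω => empGraphon (irgtAdj Hfun ω.1 ω.2)) ℓ
      (fun h => ⨅ F ∈ {F : M01 | cutMetric (inducedGraphon Hfun F) h = 0}, K F) := by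
  refine ⟨hLDPtypes.1, fun C hC => graphonLDP_upper Hsymm Hrange hGraphon ν hK hLDPtypes hcont
    hrate hC, fun O hO => ?_⟩
  rw [EReal.neg_le]
  refine le_iInf₂ fun h hh => EReal.le_coe_iInf₂ fun F hF => EReal.neg_le.1 ?_
  obtain ⟨ε, hε, hεO⟩ := hO.2 h hh
  exact graphonLDP_lower Hsymm Hrange hGraphon ν hLDPtypes hcont hrate hO
    (hεO _ (hGraphon F) ((show cutMetric _ h = 0 from hF).trans_lt hε))
end

section
/- For every e* ∈ ℝ, the set of Borel probability measures P on [0,1] satisfying ∫_{[0,1]²} min(x,y) d(P ⊗ P)(x,y) ≤ e* is a convex subset of M([0,1]). (The quantity ∫∫ min(x,y) d(P ⊗ P) equals E[X₁ ∧ X₂] for independent X₁, X₂ with law P, i.e. the constraint 2∫₀¹∫₀^y x P(dx) P(dy) ≤ e* of the variational problem.) -/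
open MeasureTheory

/-- The layer-cake formula for `∫∫ min(x,y) d(μ⊗μ)`: it is the integral of the squared tails. -/
theorem integral_min_prod_self_eq_integral_sq (μ : Measure ↥(Set.Icc (0:ℝ) 1))
    [IsFiniteMeasure μ] :
    ∫ p, min (p.1 : ℝ) (p.2 : ℝ) ∂(μ.prod μ) =
      ∫ t in Set.Ioi (0:ℝ), μ.real {x | t < (x : ℝ)} ^ 2 := by
  have hint : Integrable (fun p : ↥(Set.Icc (0:ℝ) 1) × ↥(Set.Icc (0:ℝ) 1) =>
      min (p.1 : ℝ) (p.2 : ℝ)) (μ.prod μ) := by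
    refine Integrable.of_bound (Measurable.aestronglyMeasurable (by fun_prop)) 1 (.of_forall ?_)
    intro p
    rw [Real.norm_of_nonneg (le_min p.1.2.1 p.2.2.1)]
    exact min_le_of_left_le p.1.2.2
  rw [hint.integral_eq_integral_meas_lt (.of_forall fun p => le_min p.1.2.1 p.2.2.1)]
  congr 1 with t
  have hset : {p : ↥(Set.Icc (0:ℝ) 1) × ↥(Set.Icc (0:ℝ) 1) | t < min (p.1 : ℝ) (p.2 : ℝ)} =
      {x : ↥(Set.Icc (0:ℝ) 1) | t < (x : ℝ)} ×ˢ {x : ↥(Set.Icc (0:ℝ) 1) | t < (x : ℝ)} := by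
    ext p
    simp
  rw [hset, measureReal_prod_prod, sq]

/-- The squared tail of a finite measure on `[0,1]` is integrable on the positive half-line. -/
theorem integrableOn_sq_measureReal_tail (μ : Measure ↥(Set.Icc (0:ℝ) 1)) [IsFiniteMeasure μ] :
    IntegrableOn (fun t : ℝ => μ.real {x | t < (x : ℝ)} ^ 2) (Set.Ioi 0) := by
  have hanti : Antitone fun t : ℝ => μ.real {x | t < (x : ℝ)} := fun s t hst =>
    measureReal_mono fun x (hx : t < (x : ℝ)) => hst.trans_lt hx
  have hIoc : IntegrableOn (fun t : ℝ => μ.real {x | t < (x : ℝ)} ^ 2) (Set.Ioc 0 1) := by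
    refine IntegrableOn.of_bound (by simp)
      (hanti.measurable.pow_const 2).aestronglyMeasurable (μ.real Set.univ ^ 2)
      (.of_forall fun t => ?_)
    rw [Real.norm_of_nonneg (by positivity)]
    exact pow_le_pow_left₀ measureReal_nonneg (measureReal_mono (Set.subset_univ _)) 2
  refine hIoc.of_forall_sdiff_eq_zero measurableSet_Ioi fun t ht => ?_
  have ht1 : 1 < t := by
    by_contra! h
    exact ht.2 ⟨ht.1, h⟩
  have hempty : {x : ↥(Set.Icc (0:ℝ) 1) | t < (x : ℝ)} = ∅ := by
    ext x
    simpa using x.2.2.trans ht1.le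
  simp [hempty]

/-- **Proposition 4.3** (convexity of the feasible region). For every `e* ∈ ℝ`, the set of
Borel probability measures `P` on `[0,1]` with `∫∫ min(x,y) d(P⊗P) ≤ e*` is convex: it is
closed under the convex combination `P₃ = c P₁ + (1−c) P₂`, `c ∈ [0,1]`. -/
theorem statement8
    (estar : ℝ)
    (P₁ P₂ : Measure ↥(Set.Icc (0:ℝ) 1))
    [IsProbabilityMeasure P₁] [IsProbabilityMeasure P₂]
    (c : ℝ) (hc : c ∈ Set.Icc (0:ℝ) 1)
    (h₁ : ∫ p, min (p.1 : ℝ) (p.2 : ℝ) ∂(P₁.prod P₁) ≤ estar)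
    (h₂ : ∫ p, min (p.1 : ℝ) (p.2 : ℝ) ∂(P₂.prod P₂) ≤ estar) :
    ∫ p, min (p.1 : ℝ) (p.2 : ℝ)
        ∂((ENNReal.ofReal c • P₁ + ENNReal.ofReal (1 - c) • P₂).prod
          (ENNReal.ofReal c • P₁ + ENNReal.ofReal (1 - c) • P₂)) ≤ estar := by
  obtain ⟨hc0, hc1⟩ := hc
  have hc1' : 0 ≤ 1 - c := sub_nonneg.mpr hc1
  have : IsFiniteMeasure (ENNReal.ofReal c • P₁) := P₁.smul_finite ENNReal.ofReal_ne_top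
  have : IsFiniteMeasure (ENNReal.ofReal (1 - c) • P₂) := P₂.smul_finite ENNReal.ofReal_ne_top
  have hreal (s : Set ↥(Set.Icc (0:ℝ) 1)) :
      (ENNReal.ofReal c • P₁ + ENNReal.ofReal (1 - c) • P₂).real s =
        c * P₁.real s + (1 - c) * P₂.real s := by
    rw [measureReal_add_apply, measureReal_ennreal_smul_apply, measureReal_ennreal_smul_apply,
      ENNReal.toReal_ofReal hc0, ENNReal.toReal_ofReal hc1']
  have hint₁ := (integrableOn_sq_measureReal_tail P₁).const_mul c
  have hint₂ := (integrableOn_sq_measureReal_tail P₂).const_mul (1 - c)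
  rw [integral_min_prod_self_eq_integral_sq] at h₁ h₂ ⊢
  calc
    _ ≤ ∫ t in Set.Ioi (0:ℝ), (c * P₁.real {x | t < (x : ℝ)} ^ 2 +
          (1 - c) * P₂.real {x | t < (x : ℝ)} ^ 2) := by
      refine integral_mono (integrableOn_sq_measureReal_tail _) (hint₁.add hint₂) fun t => ?_
      simp only [hreal]
      exact (even_two.convexOn_pow (𝕜 := ℝ)).2 (Set.mem_univ _) (Set.mem_univ _) hc0 hc1'
        (add_sub_cancel c 1)
    _ = c * (∫ t in Set.Ioi (0:ℝ), P₁.real {x | t < (x : ℝ)} ^ 2) +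
          (1 - c) * ∫ t in Set.Ioi (0:ℝ), P₂.real {x | t < (x : ℝ)} ^ 2 := by
      rw [integral_add hint₁ hint₂, integral_const_mul, integral_const_mul]
    _ ≤ c * estar + (1 - c) * estar := by gcongr
    _ = estar := by ring
end

section
/- Let μ and ν be Borel probability measures on [0,1] and e* ≥ 0. If ∫₀¹ μ((t,1])² dt ≤ e* and ∫₀¹ ν((t,1])² dt ≤ e*, then ∫_{[0,1]²} min(x,y) d(μ ⊗ ν)(x,y) ≤ e*. In particular, if independent pairs drawn from μ and from ν each satisfy E[min] ≤ e*, then E[X ∧ Y] ≤ e* for independent X ~ μ, Y ~ ν. -/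
open MeasureTheory

section Tail

variable {α : Type*} [MeasurableSpace α]

theorem antitone_real_setOf_lt (μ : Measure α) [IsFiniteMeasure μ] (f : α → ℝ) :
    Antitone fun t : ℝ => μ.real {x | t < f x} := fun _ _ h =>
  measureReal_mono fun _ hx => lt_of_le_of_lt h hx

theorem integrableOn_Icc_real_setOf_lt_sq (μ : Measure α) [IsFiniteMeasure μ] (f : α → ℝ)
    (a b : ℝ) : IntegrableOn (fun t : ℝ => μ.real {x | t < f x} ^ 2) (Set.Icc a b) := by
  have h : Antitone fun t : ℝ => μ.real {x | t < f x} ^ 2 := fun s t hst =>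
    pow_le_pow_left₀ measureReal_nonneg (antitone_real_setOf_lt μ f hst) 2
  exact (h.antitoneOn _).integrableOn_isCompact isCompact_Icc

/-- Layer-cake formula for the expected minimum of independent `[0,1]`-valued variables. -/
theorem integral_min_prod_eq_integral_mul {β : Type*} [MeasurableSpace β]
    (μ : Measure α) (ν : Measure β) [IsFiniteMeasure μ] [IsFiniteMeasure ν]
    {f : α → ℝ} {g : β → ℝ} (hf : Measurable f) (hg : Measurable g)
    (hf01 : ∀ x, f x ∈ Set.Icc (0 : ℝ) 1) (hg01 : ∀ y, g y ∈ Set.Icc (0 : ℝ) 1) :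
    ∫ p, min (f p.1) (g p.2) ∂(μ.prod ν) =
      ∫ t in Set.Icc (0 : ℝ) 1, μ.real {x | t < f x} * ν.real {y | t < g y} := by
  have h_nonneg (p : α × β) : 0 ≤ min (f p.1) (g p.2) := le_min (hf01 p.1).1 (hg01 p.2).1
  have h_int : Integrable (fun p : α × β => min (f p.1) (g p.2)) (μ.prod ν) := by
    refine Integrable.of_bound (C := 1) (by fun_prop) (ae_of_all _ fun p => ?_)
    rw [Real.norm_of_nonneg (h_nonneg p)]
    exact (min_le_left _ _).trans (hf01 p.1).2
  rw [h_int.integral_eq_integral_meas_lt (ae_of_all _ h_nonneg), integral_Icc_eq_integral_Ioc]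
  have h_prod (t : ℝ) : (μ.prod ν).real {p | t < min (f p.1) (g p.2)} =
      μ.real {x | t < f x} * ν.real {y | t < g y} := by
    rw [← measureReal_prod_prod]
    congr 1
    ext p
    simp
  simp_rw [h_prod]
  refine setIntegral_eq_of_subset_of_forall_sdiff_eq_zero measurableSet_Ioi
    Set.Ioc_subset_Ioi_self fun t ht => ?_
  have h_one : 1 < t := by
    by_contra! h
    exact ht.2 ⟨ht.1, h⟩
  have h_empty : {x | t < f x} = ∅ := by
    ext x
    simpa using (hf01 x).2.trans h_one.le
  simp [h_empty]

end Tail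

/-- If two independent draws from `μ` and two independent draws from `ν` each have expected
minimum at most `e*`, then so do independent `X ~ μ`, `Y ~ ν`:
`∫₀¹ μ((t,1])² dt ≤ e*` and `∫₀¹ ν((t,1])² dt ≤ e*` imply `∫∫ min(x,y) d(μ⊗ν) ≤ e*`. -/
theorem statement10
    (μ ν : Measure ↥(Set.Icc (0:ℝ) 1))
    [IsProbabilityMeasure μ] [IsProbabilityMeasure ν]
    (estar : ℝ) (hestar : 0 ≤ estar)
    (hμ : ∫ t in Set.Icc (0:ℝ) 1,
        ((μ {x : ↥(Set.Icc (0:ℝ) 1) | t < (x : ℝ)}).toReal) ^ 2 ≤ estar)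
    (hν : ∫ t in Set.Icc (0:ℝ) 1,
        ((ν {y : ↥(Set.Icc (0:ℝ) 1) | t < (y : ℝ)}).toReal) ^ 2 ≤ estar) :
    ∫ p, min (p.1 : ℝ) (p.2 : ℝ) ∂(μ.prod ν) ≤ estar := by
  rw [integral_min_prod_eq_integral_mul μ ν measurable_subtype_coe measurable_subtype_coe
    Subtype.property Subtype.property]
  have hμ_int := integrableOn_Icc_real_setOf_lt_sq μ Subtype.val 0 1
  have hν_int := integrableOn_Icc_real_setOf_lt_sq ν Subtype.val 0 1
  have h_le := integral_mono_of_nonneg (μ := volume.restrict (Set.Icc (0 : ℝ) 1))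
    (f := fun t => μ.real {x | t < (x : ℝ)} * ν.real {y | t < (y : ℝ)})
    (ae_of_all _ fun t => mul_nonneg measureReal_nonneg measureReal_nonneg)
    ((hμ_int.add hν_int).div_const 2)
    (ae_of_all _ fun t => by
      have h := two_mul_le_add_sq (μ.real {x | t < (x : ℝ)}) (ν.real {y | t < (y : ℝ)})
      simp only [Pi.add_apply]
      linarith)
  simp only [Pi.add_apply] at h_le
  rw [integral_div, integral_add hμ_int hν_int] at h_le
  simp only [Measure.real] at h_le ⊢
  linarith
end
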